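/- Let 𝒳 and 𝒴 be countably generated LFCM spaces, let F : 𝒜(𝒳) → 𝒜(𝒴) be a full and faithful *-functor, suppose 𝒜(𝒳) contains a faithful 𝒳-module, and let f : 𝒳 → 𝒴 be a coarse measurable map representing the coarse embedding f^F induced by F. Then F is naturally isomorphic to the pushforward functor f_* modulo central unitaries: for every coarse 𝒳-module C there is an approximable unitary η_C : f_*(C) → F(C) such that for every pair of coarse 𝒳-modules C, D and every approximable operator t : C → D there are central unitaries u ∈ End_{𝒜(𝒳)}(C) and v ∈ End_{𝒜(𝒳)}(D) with F(v t u) ∘ η_C = η_D ∘ f_*(t). -/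

import Mathlib

noncomputable section

open scoped ENNReal

/-! ## Relations -/

/-- Composition of relations: for `R ⊆ Z × Y` and `S ⊆ Y × X`,
`RelComp R S = {(z,x) | ∃ y, (z,y) ∈ R ∧ (y,x) ∈ S}`. -/
def RelComp {X Y Z : Type} (R : Set (Z × Y)) (S : Set (Y × X)) : Set (Z × X) :=
  {p | ∃ y, (p.1, y) ∈ R ∧ (y, p.2) ∈ S}

/-- Transpose of a relation. -/
def RelTrans {X Y : Type} (R : Set (Y × X)) : Set (X × Y) := {p | (p.2, p.1) ∈ R}

/-! ## Coarse spaces -/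

/-- A coarse structure on a set `X`. -/
structure CoarseSpace (X : Type) where
  entourages : Set (Set (X × X))
  diagonal_mem : {p : X × X | p.1 = p.2} ∈ entourages
  mem_of_subset : ∀ {E F : Set (X × X)}, E ∈ entourages → F ⊆ E → F ∈ entourages
  union_mem : ∀ {E F : Set (X × X)}, E ∈ entourages → F ∈ entourages → E ∪ F ∈ entourages
  transpose_mem : ∀ {E : Set (X × X)}, E ∈ entourages → RelTrans E ∈ entourages
  comp_mem : ∀ {E F : Set (X × X)}, E ∈ entourages → F ∈ entourages → RelComp E F ∈ entourages

namespace CoarseSpace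

variable {X Y : Type}

/-- A gauge: a symmetric entourage containing the diagonal. -/
def IsGauge (C : CoarseSpace X) (E : Set (X × X)) : Prop :=
  E ∈ C.entourages ∧ RelTrans E = E ∧ {p : X × X | p.1 = p.2} ⊆ E

/-- The `E`-neighbourhood `E[A]` of a set `A`. -/
def nbhd (E : Set (X × X)) (A : Set X) : Set X := {x | ∃ a ∈ A, (x, a) ∈ E}

/-- A set is bounded if `A × A` is contained in some entourage. -/
def IsBounded (C : CoarseSpace X) (A : Set X) : Prop := ∃ E ∈ C.entourages, A ×ˢ A ⊆ E

/-- `A ≺ B` : `A` is subordinate to `B`. -/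
def Subordinate (C : CoarseSpace X) (A B : Set X) : Prop := ∃ E ∈ C.entourages, A ⊆ nbhd E B

/-- `A ≍ B` : asymptotic equivalence of subsets. -/
def Asymptotic (C : CoarseSpace X) (A B : Set X) : Prop :=
  C.Subordinate A B ∧ C.Subordinate B A

/-- A coarse map between coarse spaces. -/
def IsCoarseMap (CX : CoarseSpace X) (CY : CoarseSpace Y) (f : X → Y) : Prop :=
  ∀ E ∈ CX.entourages, (fun p : X × X => (f p.1, f p.2)) '' E ∈ CY.entourages

/-- Two maps are close. -/
def Close (CX : CoarseSpace X) (CY : CoarseSpace Y) (f g : X → Y) : Prop :=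
  ∀ E ∈ CX.entourages, (fun p : X × X => (f p.1, g p.2)) '' E ∈ CY.entourages

/-- A coarse equivalence (of maps). -/
def IsCoarseEquivMap (CX : CoarseSpace X) (CY : CoarseSpace Y) (f : X → Y) : Prop :=
  IsCoarseMap CX CY f ∧ ∃ g : Y → X, IsCoarseMap CY CX g ∧
    Close CY CY (f ∘ g) id ∧ Close CX CX (g ∘ f) id

/-- A coarse embedding: a coarse map which is in addition expansive (equivalently, a coarse
equivalence onto its image with the subspace coarse structure). -/
def IsCoarseEmbedding (CX : CoarseSpace X) (CY : CoarseSpace Y) (f : X → Y) : Prop :=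
  IsCoarseMap CX CY f ∧
    ∀ F ∈ CY.entourages, {p : X × X | (f p.1, f p.2) ∈ F} ∈ CX.entourages

/-- A coarse structure is countably generated if it is the smallest coarse structure
containing some countable family of subsets of `X × X`. -/
def IsCountablyGenerated (C : CoarseSpace X) : Prop :=
  ∃ G : Set (Set (X × X)), G.Countable ∧ G ⊆ C.entourages ∧
    ∀ C' : CoarseSpace X, G ⊆ C'.entourages → C.entourages ⊆ C'.entourages

end CoarseSpace

/-- Subordination of relations `R₁, R₂ ⊆ Y × X` with respect to the product coarse structure. -/
def RelSub {X Y : Type} (CX : CoarseSpace X) (CY : CoarseSpace Y)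
    (R₁ R₂ : Set (Y × X)) : Prop :=
  ∃ F ∈ CY.entourages, ∃ E ∈ CX.entourages,
    ∀ p ∈ R₁, ∃ q ∈ R₂, (p.1, q.1) ∈ F ∧ (p.2, q.2) ∈ E

/-- Asymptotic equivalence of relations `R₁, R₂ ⊆ Y × X`. -/
def RelAsymp {X Y : Type} (CX : CoarseSpace X) (CY : CoarseSpace Y)
    (R₁ R₂ : Set (Y × X)) : Prop :=
  RelSub CX CY R₁ R₂ ∧ RelSub CX CY R₂ R₁

/-! ## LFCM spaces -/

/-- A discrete partition of a coarse space endowed with a Boolean algebra `meas` of subsets: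
a measurable, locally finite, controlled partition `P` such that a set is measurable iff its
intersection with every block is measurable. -/
structure IsDiscretePartition {X : Type} (C : CoarseSpace X) (meas : Set (Set X))
    (P : Set (Set X)) : Prop where
  nonempty : ∀ A ∈ P, A.Nonempty
  pairwiseDisjoint : ∀ A ∈ P, ∀ B ∈ P, A ≠ B → Disjoint A B
  covers : ⋃₀ P = Set.univ
  measurable : P ⊆ meas
  locallyFinite : ∀ B : Set X, C.IsBounded B → {A | A ∈ P ∧ (A ∩ B).Nonempty}.Finite
  controlled : ∃ E, C.IsGauge E ∧ ∀ A ∈ P, A ×ˢ A ⊆ E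
  meas_iff : ∀ B : Set X, B ∈ meas ↔ ∀ A ∈ P, B ∩ A ∈ meas

/-- A locally finite coarse measurable (LFCM) space: a coarse space together with a Boolean
algebra of subsets admitting a discrete partition (a chosen one is part of the data). -/
structure LFCMSpace (X : Type) where
  coarse : CoarseSpace X
  meas : Set (Set X)
  empty_mem : ∅ ∈ meas
  compl_mem : ∀ {A : Set X}, A ∈ meas → Aᶜ ∈ meas
  union_mem : ∀ {A B : Set X}, A ∈ meas → B ∈ meas → A ∪ B ∈ meas
  partition : Set (Set X)
  isPartition : IsDiscretePartition coarse meas partition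

namespace LFCMSpace

variable {X Y : Type}

/-- The discreteness gauge `E_disc = ⊔_{A ∈ P} A × A` of an LFCM space. -/
def disc (𝒳 : LFCMSpace X) : Set (X × X) := ⋃ A ∈ 𝒳.partition, A ×ˢ A

/-- A discreteness gauge: a gauge bounding the blocks of some discrete partition. -/
def IsDiscretenessGauge (𝒳 : LFCMSpace X) (E : Set (X × X)) : Prop :=
  𝒳.coarse.IsGauge E ∧
    ∃ P, IsDiscretePartition 𝒳.coarse 𝒳.meas P ∧ ∀ A ∈ P, A ×ˢ A ⊆ E

end LFCMSpace

/-- A coarse measurable map between LFCM spaces. -/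
def IsCoarseMeasurableMap {X Y : Type} (𝒳 : LFCMSpace X) (𝒴 : LFCMSpace Y) (f : X → Y) : Prop :=
  CoarseSpace.IsCoarseMap 𝒳.coarse 𝒴.coarse f ∧ ∀ B ∈ 𝒴.meas, f ⁻¹' B ∈ 𝒳.meas

/-! ## Coarse geometric modules -/

/-- A coarse geometric module over an LFCM space `𝒳`: a representation of the Boolean algebra
of measurable sets by orthogonal projections on a complex Hilbert space, nondegenerate on
bounded sets. -/
structure CoarseModule {X : Type} (𝒳 : LFCMSpace X) (H : Type) [NormedAddCommGroup H]
    [InnerProductSpace ℂ H] [CompleteSpace H] where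
  proj : Set X → (H →L[ℂ] H)
  proj_empty : proj ∅ = 0
  proj_selfAdjoint : ∀ A ∈ 𝒳.meas, IsSelfAdjoint (proj A)
  proj_inter : ∀ {A B : Set X}, A ∈ 𝒳.meas → B ∈ 𝒳.meas → proj (A ∩ B) = proj A ∘L proj B
  proj_union : ∀ {A B : Set X}, A ∈ 𝒳.meas → B ∈ 𝒳.meas → Disjoint A B →
      proj (A ∪ B) = proj A + proj B
  nondeg : Dense (↑(Submodule.span ℂ
      (⋃ A ∈ {A | A ∈ 𝒳.meas ∧ 𝒳.coarse.IsBounded A}, Set.range (proj A))) : Set H)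

variable {X Y Z : Type}
variable {H₀ H₁ H₂ H₃ : Type}

/-- The support of a bounded operator between Hilbert spaces carrying representations
`pX`, `pY` of the measurable sets of LFCM spaces `𝒳` (source) and `𝒴` (target). -/
def opSupp [NormedAddCommGroup H₁] [InnerProductSpace ℂ H₁]
    [NormedAddCommGroup H₂] [InnerProductSpace ℂ H₂]
    (𝒳 : LFCMSpace X) (𝒴 : LFCMSpace Y)
    (pX : Set X → (H₁ →L[ℂ] H₁)) (pY : Set Y → (H₂ →L[ℂ] H₂))
    (t : H₁ →L[ℂ] H₂) : Set (Y × X) :=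
  ⋃₀ {S | ∃ B A, S = B ×ˢ A ∧ B ∈ 𝒴.meas ∧ B ×ˢ B ⊆ 𝒴.disc ∧
      A ∈ 𝒳.meas ∧ A ×ˢ A ⊆ 𝒳.disc ∧ pY B ∘L t ∘L pX A ≠ 0}

/-- Controlled propagation of an operator between modules over the same LFCM space. -/
def HasControlledPropagation [NormedAddCommGroup H₁] [InnerProductSpace ℂ H₁]
    [NormedAddCommGroup H₂] [InnerProductSpace ℂ H₂]
    (𝒳 : LFCMSpace X) (pX : Set X → (H₁ →L[ℂ] H₁)) (pY : Set X → (H₂ →L[ℂ] H₂))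
    (t : H₁ →L[ℂ] H₂) : Prop :=
  opSupp 𝒳 𝒳 pX pY t ∈ 𝒳.coarse.entourages

/-- Approximable operators: norm-limits of controlled propagation operators. -/
def Approximable [NormedAddCommGroup H₁] [InnerProductSpace ℂ H₁]
    [NormedAddCommGroup H₂] [InnerProductSpace ℂ H₂]
    (𝒳 : LFCMSpace X) (pX : Set X → (H₁ →L[ℂ] H₁)) (pY : Set X → (H₂ →L[ℂ] H₂))
    (t : H₁ →L[ℂ] H₂) : Prop :=
  ∀ ε : ℝ, 0 < ε → ∃ s : H₁ →L[ℂ] H₂, HasControlledPropagation 𝒳 pX pY s ∧ ‖t - s‖ ≤ ε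

/-- The rank (Hilbert dimension of the range) of an operator. -/
def projRank {H : Type} [NormedAddCommGroup H] [InnerProductSpace ℂ H]
    (p : H →L[ℂ] H) : Cardinal :=
  LinearMap.rank (p : H →ₗ[ℂ] H)

/-- The `κ`-domain of a coarse module, computed with respect to an arbitrary gauge `E`. -/
def domKappaAt {X : Type} {H : Type} [NormedAddCommGroup H] [InnerProductSpace ℂ H]
    [CompleteSpace H] (𝒳 : LFCMSpace X) (M : CoarseModule 𝒳 H) (E : Set (X × X))
    (κ : Cardinal) : Set X :=
  ⋃₀ {A | A ∈ 𝒳.meas ∧ A ×ˢ A ⊆ E ∧ κ ≤ projRank (M.proj A)}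

/-- The `κ`-domain of a coarse module (with respect to the discreteness gauge). -/
def domKappa {X : Type} {H : Type} [NormedAddCommGroup H] [InnerProductSpace ℂ H]
    [CompleteSpace H] (𝒳 : LFCMSpace X) (M : CoarseModule 𝒳 H) (κ : Cardinal) : Set X :=
  domKappaAt 𝒳 M 𝒳.disc κ

/-- A coarse module is faithful if its faithfulness domain is asymptotic to the whole space. -/
def IsFaithfulMod {X : Type} {H : Type} [NormedAddCommGroup H] [InnerProductSpace ℂ H]
    [CompleteSpace H] (𝒳 : LFCMSpace X) (M : CoarseModule 𝒳 H) : Prop :=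
  𝒳.coarse.Asymptotic (domKappa 𝒳 M 1) Set.univ

/-- A coarse module is ample if its ampleness domain is asymptotic to the whole space. -/
def IsAmpleMod {X : Type} {H : Type} [NormedAddCommGroup H] [InnerProductSpace ℂ H]
    [CompleteSpace H] (𝒳 : LFCMSpace X) (M : CoarseModule 𝒳 H) : Prop :=
  𝒳.coarse.Asymptotic (domKappa 𝒳 M Cardinal.aleph0) Set.univ

/-- The approximate relation `f^T_{δ,F,E}` of a bounded operator. -/
def approxRel [NormedAddCommGroup H₁] [InnerProductSpace ℂ H₁]
    [NormedAddCommGroup H₂] [InnerProductSpace ℂ H₂]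
    (𝒳 : LFCMSpace X) (𝒴 : LFCMSpace Y)
    (pX : Set X → (H₁ →L[ℂ] H₁)) (pY : Set Y → (H₂ →L[ℂ] H₂))
    (T : H₁ →L[ℂ] H₂) (δ : ℝ) (F : Set (Y × Y)) (E : Set (X × X)) : Set (Y × X) :=
  ⋃₀ {S | ∃ B A, S = B ×ˢ A ∧ B ∈ 𝒴.meas ∧ B ×ˢ B ⊆ F ∧
      A ∈ 𝒳.meas ∧ A ×ˢ A ⊆ E ∧ δ < ‖pY B ∘L T ∘L pX A‖}

/-- A unitary operator between Hilbert spaces. -/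
def IsUnitaryOp [NormedAddCommGroup H₁] [InnerProductSpace ℂ H₁] [CompleteSpace H₁]
    [NormedAddCommGroup H₂] [InnerProductSpace ℂ H₂] [CompleteSpace H₂]
    (U : H₁ →L[ℂ] H₂) : Prop :=
  ContinuousLinearMap.adjoint U ∘L U = ContinuousLinearMap.id ℂ H₁ ∧
    U ∘L ContinuousLinearMap.adjoint U = ContinuousLinearMap.id ℂ H₂

/-- A central unitary of the C*-algebra of approximable operators on a coarse module. -/
def IsCentralUnitary {X : Type} {H : Type} [NormedAddCommGroup H] [InnerProductSpace ℂ H]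
    [CompleteSpace H] (𝒳 : LFCMSpace X) (M : CoarseModule 𝒳 H) (u : H →L[ℂ] H) : Prop :=
  Approximable 𝒳 M.proj M.proj u ∧ IsUnitaryOp u ∧
    ∀ t : H →L[ℂ] H, Approximable 𝒳 M.proj M.proj t → u ∘L t = t ∘L u

/-- Equivalence of operators modulo central unitaries. -/
def CongruentModCentral {X : Type} [NormedAddCommGroup H₁] [InnerProductSpace ℂ H₁]
    [CompleteSpace H₁] [NormedAddCommGroup H₂] [InnerProductSpace ℂ H₂] [CompleteSpace H₂]
    (𝒳 : LFCMSpace X) (C : CoarseModule 𝒳 H₁) (D : CoarseModule 𝒳 H₂)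
    (t s : H₁ →L[ℂ] H₂) : Prop :=
  ∃ u v, IsCentralUnitary 𝒳 C u ∧ IsCentralUnitary 𝒳 D v ∧ t = v ∘L s ∘L u

/-! ## Direct sums of modules -/

/-- The direct sum `T ⊕ S` of two operators, on the `ℓ²`-product of Hilbert spaces. -/
def prodOp [NormedAddCommGroup H₀] [InnerProductSpace ℂ H₀]
    [NormedAddCommGroup H₁] [InnerProductSpace ℂ H₁]
    [NormedAddCommGroup H₂] [InnerProductSpace ℂ H₂]
    [NormedAddCommGroup H₃] [InnerProductSpace ℂ H₃]
    (T : H₀ →L[ℂ] H₂) (S : H₁ →L[ℂ] H₃) :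
    WithLp 2 (H₀ × H₁) →L[ℂ] WithLp 2 (H₂ × H₃) :=
  (WithLp.prodContinuousLinearEquiv 2 ℂ H₂ H₃).symm.toContinuousLinearMap ∘L
    (T.prodMap S) ∘L (WithLp.prodContinuousLinearEquiv 2 ℂ H₀ H₁).toContinuousLinearMap

/-- The canonical inclusion `H₀ → H₀ ⊕ H₁`. -/
def inlOp (H₀ H₁ : Type) [NormedAddCommGroup H₀] [InnerProductSpace ℂ H₀]
    [NormedAddCommGroup H₁] [InnerProductSpace ℂ H₁] :
    H₀ →L[ℂ] WithLp 2 (H₀ × H₁) :=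
  (WithLp.prodContinuousLinearEquiv 2 ℂ H₀ H₁).symm.toContinuousLinearMap ∘L
    ContinuousLinearMap.inl ℂ H₀ H₁

/-- The canonical inclusion `H₁ → H₀ ⊕ H₁`. -/
def inrOp (H₀ H₁ : Type) [NormedAddCommGroup H₀] [InnerProductSpace ℂ H₀]
    [NormedAddCommGroup H₁] [InnerProductSpace ℂ H₁] :
    H₁ →L[ℂ] WithLp 2 (H₀ × H₁) :=
  (WithLp.prodContinuousLinearEquiv 2 ℂ H₀ H₁).symm.toContinuousLinearMap ∘L
    ContinuousLinearMap.inr ℂ H₀ H₁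

/-- The canonical projection `H₀ ⊕ H₁ → H₀`. -/
def fstOp (H₀ H₁ : Type) [NormedAddCommGroup H₀] [InnerProductSpace ℂ H₀]
    [NormedAddCommGroup H₁] [InnerProductSpace ℂ H₁] :
    WithLp 2 (H₀ × H₁) →L[ℂ] H₀ :=
  ContinuousLinearMap.fst ℂ H₀ H₁ ∘L
    (WithLp.prodContinuousLinearEquiv 2 ℂ H₀ H₁).toContinuousLinearMap

/-- The canonical projection `H₀ ⊕ H₁ → H₁`. -/
def sndOp (H₀ H₁ : Type) [NormedAddCommGroup H₀] [InnerProductSpace ℂ H₀]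
    [NormedAddCommGroup H₁] [InnerProductSpace ℂ H₁] :
    WithLp 2 (H₀ × H₁) →L[ℂ] H₁ :=
  ContinuousLinearMap.snd ℂ H₀ H₁ ∘L
    (WithLp.prodContinuousLinearEquiv 2 ℂ H₀ H₁).toContinuousLinearMap

/-- `M` is the direct sum of the coarse modules `C₀` and `C₁`. -/
def IsDirectSum {X : Type} [NormedAddCommGroup H₀] [InnerProductSpace ℂ H₀] [CompleteSpace H₀]
    [NormedAddCommGroup H₁] [InnerProductSpace ℂ H₁] [CompleteSpace H₁]
    (𝒳 : LFCMSpace X) (C₀ : CoarseModule 𝒳 H₀) (C₁ : CoarseModule 𝒳 H₁)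
    (M : CoarseModule 𝒳 (WithLp 2 (H₀ × H₁))) : Prop :=
  ∀ A : Set X, M.proj A = prodOp (C₀.proj A) (C₁.proj A)

/-! ## Bundled modules and *-functors -/

/-- A coarse module over `𝒳` bundled together with its Hilbert space; the objects of the
approximable category `𝒜(𝒳)`. -/
structure BundledModule {X : Type} (𝒳 : LFCMSpace X) where
  H : Type
  [instNorm : NormedAddCommGroup H]
  [instInner : InnerProductSpace ℂ H]
  [instComplete : CompleteSpace H]
  mod : CoarseModule 𝒳 H

attribute [instance] BundledModule.instNorm BundledModule.instInner BundledModule.instComplete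

/-- A *-functor `𝒜(𝒳) → 𝒜(𝒴)` between approximable categories: a map on objects together
with a ℂ-linear, multiplicative, adjoint-preserving map on approximable operators. -/
structure StarFunctor {X Y : Type} (𝒳 : LFCMSpace X) (𝒴 : LFCMSpace Y) where
  obj : BundledModule 𝒳 → BundledModule 𝒴
  map : ∀ {C D : BundledModule 𝒳} (t : C.H →L[ℂ] D.H),
      Approximable 𝒳 C.mod.proj D.mod.proj t → ((obj C).H →L[ℂ] (obj D).H)
  map_approximable : ∀ {C D : BundledModule 𝒳} (t : C.H →L[ℂ] D.H)
      (ht : Approximable 𝒳 C.mod.proj D.mod.proj t),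
      Approximable 𝒴 (obj C).mod.proj (obj D).mod.proj (map t ht)
  map_id : ∀ (C : BundledModule 𝒳)
      (h : Approximable 𝒳 C.mod.proj C.mod.proj (ContinuousLinearMap.id ℂ C.H)),
      map (ContinuousLinearMap.id ℂ C.H) h = ContinuousLinearMap.id ℂ (obj C).H
  map_comp : ∀ {C D G : BundledModule 𝒳} (t : C.H →L[ℂ] D.H) (s : D.H →L[ℂ] G.H)
      (ht : Approximable 𝒳 C.mod.proj D.mod.proj t)
      (hs : Approximable 𝒳 D.mod.proj G.mod.proj s)
      (hst : Approximable 𝒳 C.mod.proj G.mod.proj (s ∘L t)),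
      map (s ∘L t) hst = map s hs ∘L map t ht
  map_add : ∀ {C D : BundledModule 𝒳} (t s : C.H →L[ℂ] D.H)
      (ht : Approximable 𝒳 C.mod.proj D.mod.proj t)
      (hs : Approximable 𝒳 C.mod.proj D.mod.proj s)
      (hts : Approximable 𝒳 C.mod.proj D.mod.proj (t + s)),
      map (t + s) hts = map t ht + map s hs
  map_smul : ∀ {C D : BundledModule 𝒳} (c : ℂ) (t : C.H →L[ℂ] D.H)
      (ht : Approximable 𝒳 C.mod.proj D.mod.proj t)
      (hct : Approximable 𝒳 C.mod.proj D.mod.proj (c • t)),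
      map (c • t) hct = c • map t ht
  map_star : ∀ {C D : BundledModule 𝒳} (t : C.H →L[ℂ] D.H)
      (ht : Approximable 𝒳 C.mod.proj D.mod.proj t)
      (hstar : Approximable 𝒳 D.mod.proj C.mod.proj (ContinuousLinearMap.adjoint t)),
      map (ContinuousLinearMap.adjoint t) hstar = ContinuousLinearMap.adjoint (map t ht)

namespace StarFunctor

variable {𝒳 : LFCMSpace X} {𝒴 : LFCMSpace Y}

/-- A full functor. -/
def Full (F : StarFunctor 𝒳 𝒴) : Prop :=
  ∀ (C D : BundledModule 𝒳) (s : (F.obj C).H →L[ℂ] (F.obj D).H),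
    Approximable 𝒴 (F.obj C).mod.proj (F.obj D).mod.proj s →
    ∃ (t : C.H →L[ℂ] D.H) (ht : Approximable 𝒳 C.mod.proj D.mod.proj t), F.map t ht = s

/-- A faithful functor. -/
def Faithful (F : StarFunctor 𝒳 𝒴) : Prop :=
  ∀ (C D : BundledModule 𝒳) (t t' : C.H →L[ℂ] D.H)
    (ht : Approximable 𝒳 C.mod.proj D.mod.proj t)
    (ht' : Approximable 𝒳 C.mod.proj D.mod.proj t'),
    F.map t ht = F.map t' ht' → t = t'

/-- An essentially surjective functor (up to isomorphism in the approximable category). -/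
def EssSurj (F : StarFunctor 𝒳 𝒴) : Prop :=
  ∀ D' : BundledModule 𝒴, ∃ C : BundledModule 𝒳,
    ∃ u : (F.obj C).H →L[ℂ] D'.H, Approximable 𝒴 (F.obj C).mod.proj D'.mod.proj u ∧
    ∃ v : D'.H →L[ℂ] (F.obj C).H, Approximable 𝒴 D'.mod.proj (F.obj C).mod.proj v ∧
      v ∘L u = ContinuousLinearMap.id ℂ (F.obj C).H ∧
      u ∘L v = ContinuousLinearMap.id ℂ D'.H

/-- A unitary `U` implements the *-isomorphism induced by `F` on the endomorphism algebra of
a module `C`. -/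
def Implements (F : StarFunctor 𝒳 𝒴) (C : BundledModule 𝒳)
    (U : C.H →L[ℂ] (F.obj C).H) : Prop :=
  IsUnitaryOp U ∧ ∀ (t : C.H →L[ℂ] C.H) (ht : Approximable 𝒳 C.mod.proj C.mod.proj t),
    F.map t ht = U ∘L t ∘L ContinuousLinearMap.adjoint U

end StarFunctor

/-- The graph of a map, as a relation `⊆ Y × X`. -/
def mapGraph {X Y : Type} (f : X → Y) : Set (Y × X) := {p | p.1 = f p.2}

/-- A relation `R ⊆ Y × X` is a coarse equivalence from `DX ⊆ X` to `DY ⊆ Y` (each with the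
subspace coarse structure): controlled in both directions, densely defined and coarsely
surjective relative to `DX` and `DY`. -/
def IsRelCoarseEquivOn {X Y : Type} (CX : CoarseSpace X) (CY : CoarseSpace Y)
    (DX : Set X) (DY : Set Y) (R : Set (Y × X)) : Prop :=
  (∀ E ∈ CX.entourages, RelComp R (RelComp E (RelTrans R)) ∈ CY.entourages) ∧
  (∀ F ∈ CY.entourages, RelComp (RelTrans R) (RelComp F R) ∈ CX.entourages) ∧
  CX.Asymptotic (Prod.snd '' R) DX ∧ CY.Asymptotic (Prod.fst '' R) DY

/-- `S ⊆ X × Y` is a coarse inverse of the relation `R ⊆ Y × X` between `DX` and `DY`: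
both compositions are asymptotic to the respective (restricted) diagonals. -/
def IsRelCoarseInverseOn {X Y : Type} (CX : CoarseSpace X) (CY : CoarseSpace Y)
    (DX : Set X) (DY : Set Y) (R : Set (Y × X)) (S : Set (X × Y)) : Prop :=
  RelAsymp CX CX (RelComp S R) {p : X × X | p.1 = p.2 ∧ p.1 ∈ DX} ∧
  RelAsymp CY CY (RelComp R S) {p : Y × Y | p.1 = p.2 ∧ p.1 ∈ DY}

/-- The statement that a coarse map `f` represents the coarse embedding induced by a full and
faithful *-functor `F` via approximate relations of implementing unitaries. -/
def RepresentsInducedEmbedding {X Y : Type} {𝒳 : LFCMSpace X} {𝒴 : LFCMSpace Y}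
    (F : StarFunctor 𝒳 𝒴) (f : X → Y) : Prop :=
  ∀ (C : BundledModule 𝒳), IsFaithfulMod 𝒳 C.mod →
  ∀ (U : C.H →L[ℂ] (F.obj C).H), F.Implements C U →
  ∀ δ : ℝ, 0 < δ → δ < 1 →
  ∃ F₀ ∈ 𝒴.coarse.entourages, ∃ E₀ ∈ 𝒳.coarse.entourages,
    ∀ F' ∈ 𝒴.coarse.entourages, F₀ ⊆ F' → ∀ E ∈ 𝒳.coarse.entourages, E₀ ⊆ E →
      RelAsymp 𝒳.coarse 𝒴.coarse
        (approxRel 𝒳 𝒴 C.mod.proj (F.obj C).mod.proj U δ F' E) (mapGraph f)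

/-- Bundle a coarse module into an object of the approximable category. -/
abbrev BundledModule.ofModule {X : Type} {𝒳 : LFCMSpace X} {H : Type} [NormedAddCommGroup H]
    [InnerProductSpace ℂ H] [CompleteSpace H] (M : CoarseModule 𝒳 H) : BundledModule 𝒳 :=
  ⟨H, M⟩

theorem LFCMSpace.disc_mem {X : Type} (𝒳 : LFCMSpace X) :
    𝒳.disc ∈ 𝒳.coarse.entourages := by
  obtain ⟨E, hE, hEP⟩ := 𝒳.isPartition.controlled
  refine 𝒳.coarse.mem_of_subset hE.1 ?_
  intro p hp
  simp only [LFCMSpace.disc, Set.mem_iUnion] at hp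
  obtain ⟨A, hA, hpA⟩ := hp
  exact hEP A hA hpA

theorem prodOp_comp_inlOp {H₀ H₁ H₂ H₃ : Type}
    [NormedAddCommGroup H₀] [InnerProductSpace ℂ H₀]
    [NormedAddCommGroup H₁] [InnerProductSpace ℂ H₁]
    [NormedAddCommGroup H₂] [InnerProductSpace ℂ H₂]
    [NormedAddCommGroup H₃] [InnerProductSpace ℂ H₃]
    (T : H₀ →L[ℂ] H₂) (S : H₁ →L[ℂ] H₃) :
    prodOp T S ∘L inlOp H₀ H₁ = inlOp H₂ H₃ ∘L T := by
  ext x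
  simp [prodOp, inlOp]

theorem prodOp_comp_inrOp {H₀ H₁ H₂ H₃ : Type}
    [NormedAddCommGroup H₀] [InnerProductSpace ℂ H₀]
    [NormedAddCommGroup H₁] [InnerProductSpace ℂ H₁]
    [NormedAddCommGroup H₂] [InnerProductSpace ℂ H₂]
    [NormedAddCommGroup H₃] [InnerProductSpace ℂ H₃]
    (T : H₀ →L[ℂ] H₂) (S : H₁ →L[ℂ] H₃) :
    prodOp T S ∘L inrOp H₀ H₁ = inrOp H₂ H₃ ∘L S := by
  ext x
  simp [prodOp, inrOp]

/-- The canonical inclusion into a direct sum of coarse modules is approximable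
(indeed it has controlled propagation). -/
theorem IsDirectSum.approximable_inl {X : Type} {H₀ H₁ : Type}
    [NormedAddCommGroup H₀] [InnerProductSpace ℂ H₀] [CompleteSpace H₀]
    [NormedAddCommGroup H₁] [InnerProductSpace ℂ H₁] [CompleteSpace H₁]
    {𝒳 : LFCMSpace X} {C₀ : CoarseModule 𝒳 H₀} {C₁ : CoarseModule 𝒳 H₁}
    {M : CoarseModule 𝒳 (WithLp 2 (H₀ × H₁))} (hM : IsDirectSum 𝒳 C₀ C₁ M) :
    Approximable 𝒳 C₀.proj M.proj (inlOp H₀ H₁) := by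
  intro ε hε
  refine ⟨inlOp H₀ H₁, ?_, by simp [hε.le]⟩
  refine 𝒳.coarse.mem_of_subset (𝒳.coarse.comp_mem 𝒳.disc_mem 𝒳.disc_mem) ?_
  rintro ⟨y, x⟩ hyx
  obtain ⟨s, ⟨B, A, rfl, hBmeas, hBb, hAmeas, hAb, hne⟩, hmem⟩ := hyx
  have key : M.proj B ∘L inlOp H₀ H₁ ∘L C₀.proj A
      = inlOp H₀ H₁ ∘L C₀.proj (B ∩ A) := by
    rw [C₀.proj_inter hBmeas hAmeas, hM B, ← ContinuousLinearMap.comp_assoc,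
      prodOp_comp_inlOp, ContinuousLinearMap.comp_assoc]
  have hBA : (B ∩ A).Nonempty := by
    by_contra h
    rw [Set.not_nonempty_iff_eq_empty] at h
    apply hne
    rw [key, h, C₀.proj_empty]
    ext z
    simp
  obtain ⟨z, hzB, hzA⟩ := hBA
  obtain ⟨hyB, hxA⟩ := hmem
  exact ⟨z, hBb ⟨hyB, hzB⟩, hAb ⟨hzA, hxA⟩⟩

theorem IsDirectSum.approximable_inr {X : Type} {H₀ H₁ : Type}
    [NormedAddCommGroup H₀] [InnerProductSpace ℂ H₀] [CompleteSpace H₀]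
    [NormedAddCommGroup H₁] [InnerProductSpace ℂ H₁] [CompleteSpace H₁]
    {𝒳 : LFCMSpace X} {C₀ : CoarseModule 𝒳 H₀} {C₁ : CoarseModule 𝒳 H₁}
    {M : CoarseModule 𝒳 (WithLp 2 (H₀ × H₁))} (hM : IsDirectSum 𝒳 C₀ C₁ M) :
    Approximable 𝒳 C₁.proj M.proj (inrOp H₀ H₁) := by
  intro ε hε
  refine ⟨inrOp H₀ H₁, ?_, by simp [hε.le]⟩
  refine 𝒳.coarse.mem_of_subset (𝒳.coarse.comp_mem 𝒳.disc_mem 𝒳.disc_mem) ?_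
  rintro ⟨y, x⟩ hyx
  obtain ⟨s, ⟨B, A, rfl, hBmeas, hBb, hAmeas, hAb, hne⟩, hmem⟩ := hyx
  have key : M.proj B ∘L inrOp H₀ H₁ ∘L C₁.proj A
      = inrOp H₀ H₁ ∘L C₁.proj (B ∩ A) := by
    rw [C₁.proj_inter hBmeas hAmeas, hM B, ← ContinuousLinearMap.comp_assoc,
      prodOp_comp_inrOp, ContinuousLinearMap.comp_assoc]
  have hBA : (B ∩ A).Nonempty := by
    by_contra h
    rw [Set.not_nonempty_iff_eq_empty] at h
    apply hne
    rw [key, h, C₁.proj_empty]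
    ext z
    simp
  obtain ⟨z, hzB, hzA⟩ := hBA
  obtain ⟨hyB, hxA⟩ := hmem
  exact ⟨z, hBb ⟨hyB, hzB⟩, hAb ⟨hzA, hxA⟩⟩

/-! ## Block decomposition of a coarse module -/

section BlockDecomposition

/-- The union of a set of blocks of the chosen discrete partition. -/
def LFCMSpace.blockUnion (𝒳 : LFCMSpace X) (S : Set 𝒳.partition) : Set X :=
  ⋃ i ∈ S, (i : Set X)

namespace LFCMSpace

variable (𝒳 : LFCMSpace X)

theorem mem_blockUnion {S : Set 𝒳.partition} {x : X} :
    x ∈ 𝒳.blockUnion S ↔ ∃ i ∈ S, x ∈ (i : Set X) := by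
  simp [blockUnion]

theorem block_nonempty (i : 𝒳.partition) : (i : Set X).Nonempty :=
  𝒳.isPartition.nonempty _ i.2

theorem block_meas (i : 𝒳.partition) : (i : Set X) ∈ 𝒳.meas :=
  𝒳.isPartition.measurable i.2

theorem block_eq_of_mem {i j : 𝒳.partition} {x : X} (hi : x ∈ (i : Set X))
    (hj : x ∈ (j : Set X)) : i = j := by
  by_contra h
  have := 𝒳.isPartition.pairwiseDisjoint _ i.2 _ j.2 (fun h' => h (Subtype.ext h'))
  exact Set.disjoint_left.1 this hi hj

theorem exists_block (x : X) : ∃ i : 𝒳.partition, x ∈ (i : Set X) := by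
  have : x ∈ ⋃₀ 𝒳.partition := by rw [𝒳.isPartition.covers]; trivial
  obtain ⟨A, hA, hx⟩ := this
  exact ⟨⟨A, hA⟩, hx⟩

theorem blockUnion_meas (S : Set 𝒳.partition) : 𝒳.blockUnion S ∈ 𝒳.meas := by
  rw [𝒳.isPartition.meas_iff]
  intro A hA
  by_cases h : (⟨A, hA⟩ : 𝒳.partition) ∈ S
  · convert 𝒳.isPartition.measurable hA
    refine Set.inter_eq_right.2 fun x hx => (𝒳.mem_blockUnion).2 ⟨_, h, hx⟩
  · convert 𝒳.empty_mem
    refine Set.eq_empty_of_forall_notMem ?_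
    rintro x ⟨hx, hxA⟩
    obtain ⟨i, hi, hxi⟩ := (𝒳.mem_blockUnion).1 hx
    exact h (𝒳.block_eq_of_mem (j := ⟨A, hA⟩) hxi hxA ▸ hi)

theorem blockUnion_inter (S T : Set 𝒳.partition) :
    𝒳.blockUnion (S ∩ T) = 𝒳.blockUnion S ∩ 𝒳.blockUnion T := by
  ext x
  simp only [Set.mem_inter_iff, mem_blockUnion]
  constructor
  · rintro ⟨i, ⟨hS, hT⟩, hx⟩
    exact ⟨⟨i, hS, hx⟩, ⟨i, hT, hx⟩⟩
  · rintro ⟨⟨i, hS, hx⟩, ⟨j, hT, hx'⟩⟩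
    obtain rfl := 𝒳.block_eq_of_mem hx hx'
    exact ⟨i, ⟨hS, hT⟩, hx⟩

theorem blockUnion_union (S T : Set 𝒳.partition) :
    𝒳.blockUnion (S ∪ T) = 𝒳.blockUnion S ∪ 𝒳.blockUnion T := by
  ext x
  simp only [Set.mem_union, mem_blockUnion, or_and_right, exists_or]

@[simp] theorem blockUnion_singleton (i : 𝒳.partition) : 𝒳.blockUnion {i} = i := by
  simp [blockUnion]

@[simp] theorem blockUnion_empty : 𝒳.blockUnion ∅ = ∅ := by
  simp [blockUnion]

theorem block_prod_subset_disc (i : 𝒳.partition) : (i : Set X) ×ˢ (i : Set X) ⊆ 𝒳.disc :=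
  Set.subset_biUnion_of_mem (u := fun A : Set X => A ×ˢ A) i.2

theorem exists_block_of_mem_disc {x y : X} (h : (x, y) ∈ 𝒳.disc) :
    ∃ i : 𝒳.partition, x ∈ (i : Set X) ∧ y ∈ (i : Set X) := by
  simp only [disc, Set.mem_iUnion] at h
  obtain ⟨A, hA, hx, hy⟩ := h
  exact ⟨⟨A, hA⟩, hx, hy⟩

theorem subset_block {A : Set X} (hA : A ×ˢ A ⊆ 𝒳.disc) {i : 𝒳.partition} {x : X}
    (hx : x ∈ A) (hi : x ∈ (i : Set X)) : A ⊆ i := by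
  intro y hy
  obtain ⟨j, hj, hj'⟩ := 𝒳.exists_block_of_mem_disc (hA (Set.mk_mem_prod hx hy))
  rwa [𝒳.block_eq_of_mem hi hj]

theorem finite_blocks_of_isBounded {B : Set X} (hB : 𝒳.coarse.IsBounded B) :
    {i : 𝒳.partition | ((i : Set X) ∩ B).Nonempty}.Finite := by
  refine Set.Finite.of_finite_image ((𝒳.isPartition.locallyFinite B hB).subset ?_)
    (Subtype.val_injective.injOn)
  rintro _ ⟨i, hi, rfl⟩
  exact ⟨i.2, hi⟩

/-- The blocks all of whose points are `G`-close to `b`. -/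
def near (G : Set (X × X)) (b : X) : Set 𝒳.partition := {k | (k : Set X) ×ˢ {b} ⊆ G}

theorem near_mono {G G' : Set (X × X)} (h : G ⊆ G') (b : X) : 𝒳.near G b ⊆ 𝒳.near G' b :=
  fun _ hk => hk.trans h

theorem isBounded_section {G : Set (X × X)} (hG : G ∈ 𝒳.coarse.entourages) (b : X) :
    𝒳.coarse.IsBounded {x | (x, b) ∈ G} := by
  refine ⟨_, 𝒳.coarse.comp_mem hG (𝒳.coarse.transpose_mem hG), ?_⟩
  rintro ⟨x, y⟩ ⟨hx, hy⟩
  exact ⟨b, hx, hy⟩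

theorem near_finite {G : Set (X × X)} (hG : G ∈ 𝒳.coarse.entourages) (b : X) :
    (𝒳.near G b).Finite := by
  refine (𝒳.finite_blocks_of_isBounded (𝒳.isBounded_section hG b)).subset ?_
  intro k hk
  obtain ⟨x, hx⟩ := 𝒳.block_nonempty k
  exact ⟨x, hx, hk (Set.mk_mem_prod hx rfl)⟩

theorem exists_finset_subset_blockUnion {A : Set X} (hb : 𝒳.coarse.IsBounded A) :
    ∃ J : Finset 𝒳.partition, A ⊆ 𝒳.blockUnion J := by
  refine ⟨(𝒳.finite_blocks_of_isBounded hb).toFinset, fun x hx => ?_⟩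
  obtain ⟨i, hi⟩ := 𝒳.exists_block x
  exact 𝒳.mem_blockUnion.2 ⟨i, by simpa using ⟨x, hi, hx⟩, hi⟩

end LFCMSpace

namespace CoarseModule

variable [NormedAddCommGroup H₁] [InnerProductSpace ℂ H₁] [CompleteSpace H₁]
variable {𝒳 : LFCMSpace X} (M : CoarseModule 𝒳 H₁)

/-- The projection of a coarse module onto a union of blocks. -/
def blockProj (S : Set 𝒳.partition) : H₁ →L[ℂ] H₁ := M.proj (𝒳.blockUnion S)

theorem blockProj_singleton (i : 𝒳.partition) : M.blockProj {i} = M.proj i := by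
  simp [blockProj]

@[simp] theorem blockProj_empty : M.blockProj ∅ = 0 := by
  simp [blockProj, M.proj_empty]

theorem blockProj_comp (S T : Set 𝒳.partition) (x : H₁) :
    M.blockProj S (M.blockProj T x) = M.blockProj (S ∩ T) x := by
  simp [blockProj, 𝒳.blockUnion_inter,
    M.proj_inter (𝒳.blockUnion_meas S) (𝒳.blockUnion_meas T)]

theorem blockProj_comp_of_subset {S T : Set 𝒳.partition} (h : S ⊆ T) (x : H₁) :
    M.blockProj S (M.blockProj T x) = M.blockProj S x := by
  rw [blockProj_comp, Set.inter_eq_left.2 h]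

theorem blockProj_comp_of_subset' {S T : Set 𝒳.partition} (h : S ⊆ T) (x : H₁) :
    M.blockProj T (M.blockProj S x) = M.blockProj S x := by
  rw [blockProj_comp, Set.inter_eq_right.2 h]

theorem blockProj_comp_of_disjoint {S T : Set 𝒳.partition} (h : Disjoint S T) (x : H₁) :
    M.blockProj S (M.blockProj T x) = 0 := by
  rw [blockProj_comp, h.inter_eq, blockProj_empty]; rfl

@[simp] theorem blockProj_idem (S : Set 𝒳.partition) (x : H₁) :
    M.blockProj S (M.blockProj S x) = M.blockProj S x :=
  M.blockProj_comp_of_subset subset_rfl x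

theorem blockProj_union {S T : Set 𝒳.partition} (h : Disjoint S T) (x : H₁) :
    M.blockProj (S ∪ T) x = M.blockProj S x + M.blockProj T x := by
  have : Disjoint (𝒳.blockUnion S) (𝒳.blockUnion T) := by
    rw [Set.disjoint_iff_inter_eq_empty, ← 𝒳.blockUnion_inter, h.inter_eq, 𝒳.blockUnion_empty]
  simp [blockProj, 𝒳.blockUnion_union,
    M.proj_union (𝒳.blockUnion_meas S) (𝒳.blockUnion_meas T) this]

theorem adjoint_proj {A : Set X} (hA : A ∈ 𝒳.meas) :
    ContinuousLinearMap.adjoint (M.proj A) = M.proj A :=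
  ContinuousLinearMap.isSelfAdjoint_iff'.1 (M.proj_selfAdjoint A hA)

theorem inner_proj_left {A : Set X} (hA : A ∈ 𝒳.meas) (x y : H₁) :
    inner ℂ (M.proj A x) y = inner ℂ x (M.proj A y) := by
  conv_lhs => rw [← M.adjoint_proj hA]
  rw [ContinuousLinearMap.adjoint_inner_left]

theorem inner_blockProj_left (S : Set 𝒳.partition) (x y : H₁) :
    inner ℂ (M.blockProj S x) y = inner ℂ x (M.blockProj S y) :=
  M.inner_proj_left (𝒳.blockUnion_meas S) x y

theorem proj_proj {A : Set X} (hA : A ∈ 𝒳.meas) (x : H₁) :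
    M.proj A (M.proj A x) = M.proj A x := by
  have := M.proj_inter hA hA
  rw [Set.inter_self] at this
  conv_rhs => rw [this]
  rfl

theorem norm_proj_le {A : Set X} (hA : A ∈ 𝒳.meas) (x : H₁) : ‖M.proj A x‖ ≤ ‖x‖ := by
  by_cases h : ‖M.proj A x‖ = 0
  · rw [h]; exact norm_nonneg _
  have h1 : ‖M.proj A x‖ * ‖M.proj A x‖ ≤ ‖M.proj A x‖ * ‖x‖ := by
    rw [← inner_self_eq_norm_mul_norm (𝕜 := ℂ), M.inner_proj_left hA, M.proj_proj hA,
      mul_comm]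
    exact (Complex.re_le_norm _).trans (norm_inner_le_norm _ _)
  exact le_of_mul_le_mul_left h1 (lt_of_le_of_ne (norm_nonneg _) (Ne.symm h))

theorem norm_blockProj_le (S : Set 𝒳.partition) (x : H₁) : ‖M.blockProj S x‖ ≤ ‖x‖ :=
  M.norm_proj_le (𝒳.blockUnion_meas S) x

theorem opNorm_blockProj_le (S : Set 𝒳.partition) : ‖M.blockProj S‖ ≤ 1 :=
  ContinuousLinearMap.opNorm_le_bound _ zero_le_one fun x => by
    rw [one_mul]; exact M.norm_blockProj_le S x

theorem blockProj_coe_finset (J : Finset 𝒳.partition) (x : H₁) :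
    M.blockProj (J : Set 𝒳.partition) x = ∑ i ∈ J, M.blockProj {i} x := by
  classical
  induction J using Finset.induction_on with
  | empty => simp
  | insert i J hi ih =>
    rw [Finset.sum_insert hi, Finset.coe_insert, Set.insert_eq, M.blockProj_union, ih]
    simpa using hi

theorem proj_of_subset {A B : Set X} (hA : A ∈ 𝒳.meas) (hB : B ∈ 𝒳.meas) (h : A ⊆ B) (x : H₁) :
    M.proj B (M.proj A x) = M.proj A x := by
  have := M.proj_inter hB hA
  rw [Set.inter_eq_right.2 h] at this
  conv_rhs => rw [this]
  rfl

theorem proj_of_subset' {A B : Set X} (hA : A ∈ 𝒳.meas) (hB : B ∈ 𝒳.meas) (h : A ⊆ B) (x : H₁) :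
    M.proj A (M.proj B x) = M.proj A x := by
  have := M.proj_inter hA hB
  rw [Set.inter_eq_left.2 h] at this
  conv_rhs => rw [this]
  rfl

theorem dense_span_blocks :
    Dense (↑(Submodule.span ℂ (⋃ i : 𝒳.partition, Set.range (M.blockProj {i}))) : Set H₁) := by
  refine M.nondeg.mono ?_
  rw [SetLike.coe_subset_coe]
  refine Submodule.span_le.2 ?_
  refine Set.iUnion₂_subset ?_
  rintro A ⟨hA, hb⟩ _ ⟨x, rfl⟩
  obtain ⟨J, hJ⟩ := 𝒳.exists_finset_subset_blockUnion hb
  have : M.proj A x = ∑ i ∈ J, M.blockProj {i} (M.proj A x) := by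
    rw [← blockProj_coe_finset]
    exact (M.proj_of_subset hA (𝒳.blockUnion_meas _) hJ x).symm
  rw [this]
  exact Submodule.sum_mem _ fun i _ =>
    Submodule.subset_span (Set.mem_iUnion.2 ⟨i, Set.mem_range_self _⟩)

theorem ext_blocks {V : Type} [NormedAddCommGroup V] [InnerProductSpace ℂ V]
    {s t : H₁ →L[ℂ] V}
    (h : ∀ i x, s (M.blockProj {i} x) = t (M.blockProj {i} x)) : s = t := by
  refine ContinuousLinearMap.ext_on M.dense_span_blocks ?_
  rintro z hz
  obtain ⟨i, x, rfl⟩ := Set.mem_iUnion.1 hz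
  exact h i x

theorem blockProj_univ (x : H₁) : M.blockProj Set.univ x = x := by
  have : M.blockProj Set.univ = ContinuousLinearMap.id ℂ H₁ :=
    M.ext_blocks fun i x => M.blockProj_comp_of_subset' (Set.subset_univ _) x
  rw [this]; rfl

theorem blockProj_compl (S : Set 𝒳.partition) (x : H₁) :
    M.blockProj Sᶜ x = x - M.blockProj S x := by
  rw [eq_sub_iff_add_eq', ← M.blockProj_union disjoint_compl_right, Set.union_compl_self,
    M.blockProj_univ]

theorem eq_zero_of_blocks {x : H₁} (h : ∀ i, M.blockProj {i} x = 0) : x = 0 := by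
  have : innerSL ℂ x = 0 := M.ext_blocks fun i y => by
    rw [innerSL_apply_apply, ← M.inner_blockProj_left, h i]; simp
  rw [← inner_self_eq_zero (𝕜 := ℂ), ← innerSL_apply_apply, this]; rfl

theorem exists_finset_approx (x : H₁) {ε : ℝ} (hε : 0 < ε) :
    ∃ J : Finset 𝒳.partition, ∀ S : Set 𝒳.partition, (J : Set 𝒳.partition) ⊆ S →
      ‖x - M.blockProj S x‖ ≤ ε := by
  classical
  have key : ∀ z ∈ Submodule.span ℂ (⋃ i : 𝒳.partition, Set.range (M.blockProj {i})),
      ∃ J : Finset 𝒳.partition, M.blockProj (J : Set 𝒳.partition) z = z := by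
    intro z hz
    induction hz using Submodule.span_induction with
    | mem z hz =>
      obtain ⟨i, y, rfl⟩ := Set.mem_iUnion.1 hz
      exact ⟨{i}, by simp⟩
    | zero => exact ⟨∅, by simp⟩
    | add y z _ _ hy hz =>
      obtain ⟨J, hJ⟩ := hy
      obtain ⟨K, hK⟩ := hz
      refine ⟨J ∪ K, ?_⟩
      rw [map_add]
      congr 1
      · rw [← hJ, M.blockProj_comp_of_subset' (by simp)]
      · rw [← hK, M.blockProj_comp_of_subset' (by simp)]
    | smul c z _ hz =>
      obtain ⟨J, hJ⟩ := hz
      exact ⟨J, by rw [map_smul, hJ]⟩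
  obtain ⟨z, hz, hxz⟩ := M.dense_span_blocks.exists_dist_lt x hε
  obtain ⟨J, hJ⟩ := key z hz
  refine ⟨J, fun S hS => ?_⟩
  have hz' : M.blockProj Sᶜ z = 0 := by
    rw [M.blockProj_compl, ← hJ, M.blockProj_comp_of_subset' hS, sub_self]
  rw [← M.blockProj_compl, ← sub_zero (M.blockProj Sᶜ x), ← hz', ← map_sub]
  refine (M.norm_blockProj_le _ _).trans ?_
  rw [← dist_eq_norm]; exact hxz.le

end CoarseModule

end BlockDecomposition

/-! ## Blockwise control of propagation -/

section Propagation

open ContinuousLinearMap InnerProductSpace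

variable [NormedAddCommGroup H₁] [InnerProductSpace ℂ H₁] [CompleteSpace H₁]
variable [NormedAddCommGroup H₂] [InnerProductSpace ℂ H₂] [CompleteSpace H₂]
variable [NormedAddCommGroup H₃] [InnerProductSpace ℂ H₃] [CompleteSpace H₃]
variable {𝒳 : LFCMSpace X} {M : CoarseModule 𝒳 H₁} {N : CoarseModule 𝒳 H₂}
variable {L : CoarseModule 𝒳 H₃}

/-- An operator has propagation in `G` if all its nonzero block entries lie in `G`. -/
def IsCtrl (M : CoarseModule 𝒳 H₁) (N : CoarseModule 𝒳 H₂) (G : Set (X × X))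
    (t : H₁ →L[ℂ] H₂) : Prop :=
  ∀ (k i : 𝒳.partition) (x : H₁), N.blockProj {k} (t (M.blockProj {i} x)) ≠ 0 →
    (k : Set X) ×ˢ (i : Set X) ⊆ G

/-- An operator is `ε`-close to an operator with propagation in `G`. -/
def ApproxWithin (M : CoarseModule 𝒳 H₁) (N : CoarseModule 𝒳 H₂) (G : Set (X × X)) (ε : ℝ)
    (t : H₁ →L[ℂ] H₂) : Prop :=
  ∃ c, IsCtrl M N G c ∧ ‖t - c‖ ≤ ε

theorem isCtrl_iff_opSupp_subset {G : Set (X × X)} {t : H₁ →L[ℂ] H₂} :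
    IsCtrl M N G t ↔ opSupp 𝒳 𝒳 M.proj N.proj t ⊆ G := by
  constructor
  · intro h
    refine Set.sUnion_subset ?_
    rintro _ ⟨B, A, rfl, hBm, hBd, hAm, hAd, hne⟩
    rintro ⟨b, a⟩ ⟨hb, ha⟩
    obtain ⟨k, hk⟩ := 𝒳.exists_block b
    obtain ⟨i, hi⟩ := 𝒳.exists_block a
    have hBk := 𝒳.subset_block hBd hb hk
    have hAi := 𝒳.subset_block hAd ha hi
    obtain ⟨x, hx⟩ := DFunLike.ne_iff.1 hne
    refine h k i (M.proj A x) ?_ (Set.mk_mem_prod hk hi)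
    intro h0
    apply hx
    rw [M.blockProj_singleton, M.proj_of_subset hAm (𝒳.block_meas i) hAi,
      N.blockProj_singleton] at h0
    simp only [coe_comp, Function.comp_apply, zero_apply]
    rw [← N.proj_of_subset' hBm (𝒳.block_meas k) hBk, h0, map_zero]
  · intro h k i x hx
    refine subset_trans ?_ h
    refine Set.subset_sUnion_of_mem ⟨k, i, rfl, 𝒳.block_meas k, 𝒳.block_prod_subset_disc k,
      𝒳.block_meas i, 𝒳.block_prod_subset_disc i, fun h0 => hx ?_⟩
    rw [N.blockProj_singleton, M.blockProj_singleton]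
    exact congrArg (fun s => s x) h0

theorem approximable_iff {t : H₁ →L[ℂ] H₂} :
    Approximable 𝒳 M.proj N.proj t ↔
      ∀ ε : ℝ, 0 < ε → ∃ G ∈ 𝒳.coarse.entourages, ApproxWithin M N G ε t := by
  refine forall₂_congr fun ε hε => ?_
  constructor
  · rintro ⟨s, hs, hts⟩
    exact ⟨_, hs, s, isCtrl_iff_opSupp_subset.2 subset_rfl, hts⟩
  · rintro ⟨G, hG, s, hs, hts⟩
    exact ⟨s, 𝒳.coarse.mem_of_subset hG (isCtrl_iff_opSupp_subset.1 hs), hts⟩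

namespace IsCtrl

variable {G G' : Set (X × X)} {s t : H₁ →L[ℂ] H₂}

theorem mono (h : IsCtrl M N G t) (hG : G ⊆ G') : IsCtrl M N G' t :=
  fun k i x hx => (h k i x hx).trans hG

theorem zero : IsCtrl M N G (0 : H₁ →L[ℂ] H₂) := fun k i x hx => by simp at hx

theorem add (hs : IsCtrl M N G s) (ht : IsCtrl M N G t) : IsCtrl M N G (s + t) := by
  intro k i x hx
  by_cases h : N.blockProj {k} (s (M.blockProj {i} x)) = 0
  · refine ht k i x fun h' => hx ?_
    simp [h, h']
  · exact hs k i x h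

theorem smul (a : ℂ) (ht : IsCtrl M N G t) : IsCtrl M N G (a • t) := by
  intro k i x hx
  refine ht k i x fun h' => hx ?_
  simp [h']

theorem neg (ht : IsCtrl M N G t) : IsCtrl M N G (-t) := by
  simpa using ht.smul (-1)

theorem sub (hs : IsCtrl M N G s) (ht : IsCtrl M N G t) : IsCtrl M N G (s - t) := by
  simpa [sub_eq_add_neg] using hs.add ht.neg

theorem sum {ι : Type*} (J : Finset ι) {c : ι → H₁ →L[ℂ] H₂} (h : ∀ j ∈ J, IsCtrl M N G (c j)) :
    IsCtrl M N G (∑ j ∈ J, c j) := by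
  classical
  induction J using Finset.induction_on with
  | empty => simpa using zero
  | insert j J hj ih =>
    rw [Finset.sum_insert hj]
    exact (h j (by simp)).add (ih fun i hi => h i (by simp [hi]))

theorem blockProj_apply_eq_zero (h : IsCtrl M N G t) {S T : Set 𝒳.partition}
    (hST : ∀ k ∈ S, ∀ i ∈ T, ¬ (k : Set X) ×ˢ (i : Set X) ⊆ G) (x : H₁) :
    N.blockProj S (t (M.blockProj T x)) = 0 := by
  refine N.eq_zero_of_blocks fun k => ?_
  by_cases hk : k ∈ S
  · rw [N.blockProj_comp_of_subset (by simpa using hk)]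
    have : N.blockProj {k} ∘L t ∘L M.blockProj T = 0 := M.ext_blocks fun i y => by
      simp only [coe_comp, Function.comp_apply, zero_apply]
      by_cases hi : i ∈ T
      · rw [M.blockProj_comp_of_subset' (by simpa using hi)]
        by_contra h0
        exact hST k hk i hi (h k i y h0)
      · rw [M.blockProj_comp_of_disjoint (by simpa using hi)]; simp
    exact congrArg (fun s => s x) this
  · rw [N.blockProj_comp_of_disjoint (by simpa using hk)]

theorem blockProj_image (h : IsCtrl M N G t) {S T : Set 𝒳.partition}
    (hST : ∀ (k i : 𝒳.partition), i ∈ T → (k : Set X) ×ˢ (i : Set X) ⊆ G → k ∈ S) (x : H₁) :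
    N.blockProj S (t (M.blockProj T x)) = t (M.blockProj T x) := by
  have := h.blockProj_apply_eq_zero (S := Sᶜ) (T := T)
    (fun k hk i hi hki => hk (hST k i hi hki)) x
  rw [N.blockProj_compl, sub_eq_zero] at this
  exact this.symm

theorem comp {u : H₂ →L[ℂ] H₃} (hu : IsCtrl N L G u) (ht : IsCtrl M N G' t) :
    IsCtrl M L (RelComp G G') (u ∘L t) := by
  intro k i x hx
  by_contra hki
  apply hx
  rw [comp_apply, ← ht.blockProj_image (S := {j | (j : Set X) ×ˢ (i : Set X) ⊆ G'}) (T := {i})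
    (by rintro j _ rfl h; exact h)]
  refine hu.blockProj_apply_eq_zero ?_ _
  rintro _ rfl j hj hkj
  apply hki
  rintro ⟨a, b⟩ ⟨ha, hb⟩
  obtain ⟨y, hy⟩ := 𝒳.block_nonempty j
  exact ⟨y, hkj ⟨ha, hy⟩, hj ⟨hy, hb⟩⟩

theorem adjoint (ht : IsCtrl M N G t) :
    IsCtrl N M (RelTrans G) (ContinuousLinearMap.adjoint t) := by
  intro k i x hx
  have : N.blockProj {i} (t (M.blockProj {k} (M.blockProj {k}
      (ContinuousLinearMap.adjoint t (N.blockProj {i} x))))) ≠ 0 := by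
    intro h0
    apply hx
    rw [← inner_self_eq_zero (𝕜 := ℂ), M.inner_blockProj_left, adjoint_inner_left,
      N.inner_blockProj_left, h0, inner_zero_right]
  rintro ⟨a, b⟩ ⟨ha, hb⟩
  exact ht i k _ this ⟨hb, ha⟩

theorem rankOne {S T : Set 𝒳.partition} {x : H₂} {y : H₁} (hx : N.blockProj S x = x)
    (hy : M.blockProj T y = y) (h : ∀ k ∈ S, ∀ i ∈ T, (k : Set X) ×ˢ (i : Set X) ⊆ G) :
    IsCtrl M N G (InnerProductSpace.rankOne ℂ x y) := by
  intro k i z hz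
  rw [rankOne_apply, map_smul] at hz
  refine h k ?_ i ?_
  · by_contra hk
    apply hz
    rw [← hx, N.blockProj_comp_of_disjoint (by simpa using hk), smul_zero]
  · by_contra hi
    apply hz
    rw [← hy, M.inner_blockProj_left, M.blockProj_comp_of_disjoint (by simpa using hi),
      inner_zero_right, zero_smul]

end IsCtrl

theorem isCtrl_proj {A : Set X} (hA : A ∈ 𝒳.meas) : IsCtrl M M 𝒳.disc (M.proj A) := by
  intro k i x hx
  obtain rfl : k = i := by
    by_contra hki
    apply hx
    rw [M.blockProj_singleton, M.blockProj_singleton]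
    have h1 := M.proj_inter hA (𝒳.block_meas i)
    rw [Set.inter_comm, M.proj_inter (𝒳.block_meas i) hA] at h1
    have h2 : M.proj A (M.proj i x) = M.proj i (M.proj A x) := (congrArg (fun s => s x) h1).symm
    rw [h2, ← M.blockProj_singleton, ← M.blockProj_singleton,
      M.blockProj_comp_of_disjoint (by simpa using hki)]
  exact 𝒳.block_prod_subset_disc k

theorem isCtrl_blockProj (S : Set 𝒳.partition) : IsCtrl M M 𝒳.disc (M.blockProj S) :=
  isCtrl_proj (𝒳.blockUnion_meas S)

theorem isCtrl_id : IsCtrl M M 𝒳.disc (ContinuousLinearMap.id ℂ H₁) := by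
  have : M.blockProj Set.univ = ContinuousLinearMap.id ℂ H₁ := by ext x; exact M.blockProj_univ x
  rw [← this]; exact isCtrl_blockProj _

namespace ApproxWithin

variable {G G' : Set (X × X)} {s t : H₁ →L[ℂ] H₂} {ε ε' : ℝ}

theorem mono (h : ApproxWithin M N G ε t) (hG : G ⊆ G') (hε : ε ≤ ε') :
    ApproxWithin M N G' ε' t := by
  obtain ⟨c, hc, hcε⟩ := h
  exact ⟨c, hc.mono hG, hcε.trans hε⟩

theorem add (hs : ApproxWithin M N G ε s) (ht : ApproxWithin M N G ε' t) :
    ApproxWithin M N G (ε + ε') (s + t) := by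
  obtain ⟨c, hc, hcε⟩ := hs
  obtain ⟨d, hd, hdε⟩ := ht
  refine ⟨c + d, hc.add hd, ?_⟩
  rw [add_sub_add_comm]
  exact (norm_add_le _ _).trans (add_le_add hcε hdε)

theorem neg (ht : ApproxWithin M N G ε t) : ApproxWithin M N G ε (-t) := by
  obtain ⟨d, hd, hdε⟩ := ht
  refine ⟨-d, hd.neg, ?_⟩
  rwa [neg_sub_neg, norm_sub_rev]

theorem sub (hs : ApproxWithin M N G ε s) (ht : ApproxWithin M N G ε' t) :
    ApproxWithin M N G (ε + ε') (s - t) := by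
  rw [sub_eq_add_neg]; exact hs.add ht.neg

end ApproxWithin

theorem IsCtrl.approximable {G : Set (X × X)} {t : H₁ →L[ℂ] H₂} (ht : IsCtrl M N G t)
    (hG : G ∈ 𝒳.coarse.entourages) : Approximable 𝒳 M.proj N.proj t :=
  approximable_iff.2 fun ε hε => ⟨G, hG, t, ht, by simpa using hε.le⟩

theorem approximable_id : Approximable 𝒳 M.proj M.proj (ContinuousLinearMap.id ℂ H₁) :=
  isCtrl_id.approximable 𝒳.disc_mem

theorem approximable_zero : Approximable 𝒳 M.proj N.proj (0 : H₁ →L[ℂ] H₂) :=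
  IsCtrl.zero.approximable 𝒳.disc_mem

theorem approximable_blockProj (S : Set 𝒳.partition) :
    Approximable 𝒳 M.proj M.proj (M.blockProj S) :=
  (isCtrl_blockProj S).approximable 𝒳.disc_mem

theorem Approximable.smul' (a : ℂ) {t : H₁ →L[ℂ] H₂}
    (ht : Approximable 𝒳 M.proj N.proj t) : Approximable 𝒳 M.proj N.proj (a • t) := by
  refine approximable_iff.2 fun ε hε => ?_
  obtain ⟨G, hG, c, hc, h⟩ := approximable_iff.1 ht (ε / (‖a‖ + 1)) (by positivity)
  refine ⟨G, hG, a • c, hc.smul a, ?_⟩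
  rw [← smul_sub, norm_smul]
  calc ‖a‖ * ‖t - c‖ ≤ (‖a‖ + 1) * (ε / (‖a‖ + 1)) := by gcongr; linarith
    _ = ε := by field_simp

theorem Approximable.comp' {u : H₂ →L[ℂ] H₃} {t : H₁ →L[ℂ] H₂}
    (hu : Approximable 𝒳 N.proj L.proj u) (ht : Approximable 𝒳 M.proj N.proj t) :
    Approximable 𝒳 M.proj L.proj (u ∘L t) := by
  refine approximable_iff.2 fun ε hε => ?_
  obtain ⟨G, hG, c, hc, h⟩ := approximable_iff.1 hu (ε / 2 / (‖t‖ + 1)) (by positivity)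
  obtain ⟨G', hG', d, hd, h'⟩ := approximable_iff.1 ht (ε / 2 / (‖c‖ + 1)) (by positivity)
  refine ⟨_, 𝒳.coarse.comp_mem hG hG', c ∘L d, hc.comp hd, ?_⟩
  have : u ∘L t - c ∘L d = (u - c) ∘L t + c ∘L (t - d) := by
    ext x; simp
  rw [this]
  refine (norm_add_le _ _).trans ?_
  have h1 : ‖(u - c) ∘L t‖ ≤ ε / 2 := by
    calc _ ≤ ‖u - c‖ * ‖t‖ := opNorm_comp_le _ _
      _ ≤ ε / 2 / (‖t‖ + 1) * (‖t‖ + 1) := by gcongr; linarith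
      _ = ε / 2 := by field_simp
  have h2 : ‖c ∘L (t - d)‖ ≤ ε / 2 := by
    calc _ ≤ ‖c‖ * ‖t - d‖ := opNorm_comp_le _ _
      _ ≤ (‖c‖ + 1) * (ε / 2 / (‖c‖ + 1)) := by gcongr; linarith
      _ = ε / 2 := by field_simp
  linarith

theorem Approximable.adjoint' {t : H₁ →L[ℂ] H₂} (ht : Approximable 𝒳 M.proj N.proj t) :
    Approximable 𝒳 N.proj M.proj (ContinuousLinearMap.adjoint t) := by
  refine approximable_iff.2 fun ε hε => ?_
  obtain ⟨G, hG, c, hc, h⟩ := approximable_iff.1 ht ε hε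
  refine ⟨_, 𝒳.coarse.transpose_mem hG, _, hc.adjoint, ?_⟩
  rwa [← map_sub, LinearIsometryEquiv.norm_map]

end Propagation

/-! ## Cofinal sequences of entourages -/

/-- A countably generated coarse structure admits an increasing cofinal sequence of
entourages. -/
theorem CoarseSpace.IsCountablyGenerated.exists_cofinal {C : CoarseSpace Y}
    (h : C.IsCountablyGenerated) :
    ∃ F : ℕ → Set (Y × Y), Monotone F ∧ (∀ n, F n ∈ C.entourages) ∧
      ∀ G ∈ C.entourages, ∃ n, G ⊆ F n := by
  obtain ⟨𝒢, hc, hsub, hgen⟩ := h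
  obtain ⟨g, hg⟩ := (hc.insert {p : Y × Y | p.1 = p.2}).exists_eq_range (Set.insert_nonempty _ _)
  have hgC : ∀ n, g n ∈ C.entourages := by
    intro n
    have : g n ∈ insert {p : Y × Y | p.1 = p.2} 𝒢 := hg ▸ Set.mem_range_self n
    rcases this with h | h
    · rw [h]; exact C.diagonal_mem
    · exact hsub h
  let A : Set (Y × Y) → ℕ → Set (Y × Y) := fun F n => F ∪ g n ∪ {p : Y × Y | p.1 = p.2}
  let S : Set (Y × Y) → ℕ → Set (Y × Y) := fun F n => A F n ∪ RelTrans (A F n)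
  let F : ℕ → Set (Y × Y) :=
    fun n => Nat.rec {p : Y × Y | p.1 = p.2} (fun n F => RelComp (S F n) (S F n)) n
  have hF : ∀ n, F (n + 1) = RelComp (S (F n) n) (S (F n) n) := fun n => rfl
  have hFS : ∀ n, S (F n) n ⊆ F (n + 1) := by
    rintro n ⟨x, y⟩ hxy
    exact ⟨y, hxy, Or.inl (Or.inr rfl)⟩
  have hFA : ∀ n, A (F n) n ⊆ F (n + 1) := fun n => Set.subset_union_left.trans (hFS n)
  have hmono : Monotone F := monotone_nat_of_le_succ fun n =>
    (Set.subset_union_left.trans Set.subset_union_left).trans (hFA n)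
  have hFC : ∀ n, F n ∈ C.entourages := by
    intro n
    induction n with
    | zero => exact C.diagonal_mem
    | succ n ih =>
      have hA : A (F n) n ∈ C.entourages :=
        C.union_mem (C.union_mem ih (hgC n)) C.diagonal_mem
      have hS := C.union_mem hA (C.transpose_mem hA)
      exact C.comp_mem hS hS
  let C' : CoarseSpace Y :=
    { entourages := {E | ∃ n, E ⊆ F n}
      diagonal_mem := ⟨0, subset_rfl⟩
      mem_of_subset := by
        rintro E E' ⟨n, hn⟩ h
        exact ⟨n, h.trans hn⟩
      union_mem := by
        rintro E E' ⟨n, hn⟩ ⟨m, hm⟩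
        exact ⟨max n m, Set.union_subset (hn.trans (hmono (le_max_left _ _)))
          (hm.trans (hmono (le_max_right _ _)))⟩
      transpose_mem := by
        rintro E ⟨n, hn⟩
        refine ⟨n + 1, subset_trans ?_ (hFS n)⟩
        rintro ⟨x, y⟩ hxy
        exact Or.inr (Or.inl (Or.inl (hn hxy)))
      comp_mem := by
        rintro E E' ⟨n, hn⟩ ⟨m, hm⟩
        refine ⟨max n m + 1, ?_⟩
        rintro ⟨x, y⟩ ⟨z, hxz, hzy⟩
        exact ⟨z, Or.inl (Or.inl (Or.inl (hmono (le_max_left _ _) (hn hxz)))),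
          Or.inl (Or.inl (Or.inl (hmono (le_max_right _ _) (hm hzy))))⟩ }
  refine ⟨F, hmono, hFC, fun G hG => hgen C' ?_ hG⟩
  intro E hE
  have : E ∈ Set.range g := hg ▸ Set.mem_insert_of_mem _ hE
  obtain ⟨n, rfl⟩ := this
  exact ⟨n + 1, subset_trans (Set.subset_union_right.trans Set.subset_union_left) (hFA n)⟩

/-! ## Weak operator limits along ultrafilters -/

section WeakLimits

open ContinuousLinearMap Filter Topology

variable [NormedAddCommGroup H₁] [InnerProductSpace ℂ H₁]
variable [NormedAddCommGroup H₂] [InnerProductSpace ℂ H₂]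
variable {α : Type*} (u : Ultrafilter α)

theorem exists_weak_limit_vector [CompleteSpace H₁] {z : α → H₁} {R : ℝ}
    (hz : ∀ᶠ a in (u : Filter α), ‖z a‖ ≤ R) :
    ∃ w : H₁, ∀ y, Tendsto (fun a => inner ℂ (z a) y) u (𝓝 (inner ℂ w y)) := by
  have hex : ∀ y, ∃ l : ℂ, ‖l‖ ≤ R * ‖y‖ ∧ Tendsto (fun a => inner ℂ (z a) y) u (𝓝 l) := by
    intro y
    have hc := isCompact_closedBall (0 : ℂ) (R * ‖y‖)
    obtain ⟨l, hl, hlim⟩ := hc.ultrafilter_le_nhds (u.map fun a => inner ℂ (z a) y) (by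
      rw [Ultrafilter.coe_map, le_principal_iff, mem_map]
      filter_upwards [hz] with a ha
      rw [Set.mem_preimage, mem_closedBall_zero_iff]
      exact (norm_inner_le_norm _ _).trans (by gcongr))
    exact ⟨l, by simpa using hl, hlim⟩
  choose l hl hlim using hex
  let φ : H₁ →ₗ[ℂ] ℂ :=
    { toFun := l
      map_add' := fun x y => by
        refine tendsto_nhds_unique (hlim (x + y)) ?_
        simpa [inner_add_right] using (hlim x).add (hlim y)
      map_smul' := fun a x => by
        refine tendsto_nhds_unique (hlim (a • x)) ?_
        simpa [inner_smul_right] using (hlim x).const_mul a }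
  refine ⟨(InnerProductSpace.toDual ℂ H₁).symm (φ.mkContinuous R hl), fun y => ?_⟩
  rw [InnerProductSpace.toDual_symm_apply]
  exact hlim y

theorem norm_le_of_weak_limit_vector {u : Ultrafilter α} {z : α → H₁} {w : H₁} {R : ℝ}
    (hw : ∀ y, Tendsto (fun a => inner ℂ (z a) y) u (𝓝 (inner ℂ w y)))
    (hz : ∀ᶠ a in (u : Filter α), ‖z a‖ ≤ R) : ‖w‖ ≤ R := by
  have h1 : ‖inner ℂ w w‖ ≤ R * ‖w‖ := by
    refine le_of_tendsto (hw w).norm ?_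
    filter_upwards [hz] with a ha
    exact (norm_inner_le_norm _ _).trans (by gcongr)
  obtain ⟨a, ha⟩ := hz.exists
  by_cases h : ‖w‖ = 0
  · rw [h]; exact (norm_nonneg _).trans ha
  · rw [inner_self_eq_norm_sq_to_K] at h1
    have h2 : ‖w‖ * ‖w‖ ≤ R * ‖w‖ := by simpa [sq] using h1
    exact le_of_mul_le_mul_right h2 (lt_of_le_of_ne (norm_nonneg _) (Ne.symm h))

theorem exists_weak_limit [CompleteSpace H₂] {c : α → H₁ →L[ℂ] H₂} {R : ℝ}
    (hc : ∀ᶠ a in (u : Filter α), ‖c a‖ ≤ R) :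
    ∃ t : H₁ →L[ℂ] H₂,
      ∀ x y, Tendsto (fun a => inner ℂ (c a x) y) u (𝓝 (inner ℂ (t x) y)) := by
  have hcx : ∀ x, ∀ᶠ a in (u : Filter α), ‖c a x‖ ≤ R * ‖x‖ := fun x => by
    filter_upwards [hc] with a ha
    exact (c a).le_of_opNorm_le ha x
  choose T hT using fun x => exists_weak_limit_vector u (hcx x)
  let t : H₁ →ₗ[ℂ] H₂ :=
    { toFun := T
      map_add' := fun x x' => ext_inner_right ℂ fun y => by
        refine tendsto_nhds_unique (hT (x + x') y) ?_
        simpa [inner_add_left] using (hT x y).add (hT x' y)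
      map_smul' := fun a x => ext_inner_right ℂ fun y => by
        refine tendsto_nhds_unique (hT (a • x) y) ?_
        simpa [inner_smul_left, mul_comm] using (hT x y).const_mul ((starRingEnd ℂ) a) }
  exact ⟨t.mkContinuous R fun x => norm_le_of_weak_limit_vector (hT x) (hcx x), hT⟩

theorem norm_le_of_weak_limit {u : Ultrafilter α} {c : α → H₁ →L[ℂ] H₂} {t : H₁ →L[ℂ] H₂}
    {R : ℝ} (ht : ∀ x y, Tendsto (fun a => inner ℂ (c a x) y) u (𝓝 (inner ℂ (t x) y)))
    (hc : ∀ᶠ a in (u : Filter α), ‖c a‖ ≤ R) : ‖t‖ ≤ R := by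
  obtain ⟨a, ha⟩ := hc.exists
  refine opNorm_le_bound _ ((norm_nonneg _).trans ha) fun x => ?_
  refine norm_le_of_weak_limit_vector (ht x) ?_
  filter_upwards [hc] with a ha
  exact (c a).le_of_opNorm_le ha x

/-- Being `ε`-close to an operator with propagation in `G` is closed under bounded weak
limits. -/
theorem ApproxWithin.of_weak_limit [CompleteSpace H₁] [CompleteSpace H₂] {𝒳 : LFCMSpace X}
    {M : CoarseModule 𝒳 H₁} {N : CoarseModule 𝒳 H₂} {u : Ultrafilter α} {G : Set (X × X)} {ε R : ℝ}
    {T : α → H₁ →L[ℂ] H₂} {t : H₁ →L[ℂ] H₂}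
    (ht : ∀ x y, Tendsto (fun a => inner ℂ (T a x) y) u (𝓝 (inner ℂ (t x) y)))
    (hR : ∀ᶠ a in (u : Filter α), ‖T a‖ ≤ R)
    (hT : ∀ᶠ a in (u : Filter α), ApproxWithin M N G ε (T a)) : ApproxWithin M N G ε t := by
  classical
  let c : α → H₁ →L[ℂ] H₂ := fun a => if h : ApproxWithin M N G ε (T a) then h.choose else 0
  have hc : ∀ᶠ a in (u : Filter α), IsCtrl M N G (c a) ∧ ‖T a - c a‖ ≤ ε := by
    filter_upwards [hT] with a ha
    have : c a = ha.choose := dif_pos ha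
    rw [this]; exact ha.choose_spec
  have hcR : ∀ᶠ a in (u : Filter α), ‖c a‖ ≤ R + ε := by
    filter_upwards [hc, hR] with a ha hRa
    have : c a = T a - (T a - c a) := by abel
    rw [this]
    exact (norm_sub_le _ _).trans (add_le_add hRa ha.2)
  obtain ⟨s, hs⟩ := exists_weak_limit u hcR
  refine ⟨s, fun k i x hx => ?_, norm_le_of_weak_limit (u := u) (c := fun a => T a - c a) ?_
    (hc.mono fun a ha => ha.2)⟩
  · by_contra hki
    apply hx
    refine ext_inner_right ℂ fun y => ?_
    rw [N.inner_blockProj_left, inner_zero_left]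
    refine tendsto_nhds_unique (hs (M.blockProj {i} x) (N.blockProj {k} y)) ?_
    refine tendsto_const_nhds.congr' ?_
    filter_upwards [hc] with a ha
    have : N.blockProj {k} (c a (M.blockProj {i} x)) = 0 := by
      by_contra h0; exact hki (ha.1 k i x h0)
    rw [← N.inner_blockProj_left, this, inner_zero_left]
  · intro x y
    simpa [inner_sub_left] using (ht x y).sub (hs x y)

end WeakLimits

/-! ## Uniform approximability of block projections -/

section UniformApproximation

open ContinuousLinearMap Filter Topology

variable [NormedAddCommGroup H₁] [InnerProductSpace ℂ H₁] [CompleteSpace H₁]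
variable [NormedAddCommGroup H₂] [InnerProductSpace ℂ H₂] [CompleteSpace H₂]
variable {𝒳 : LFCMSpace X} {𝒴 : LFCMSpace Y}

theorem CoarseModule.continuous_blockProj_apply (M : CoarseModule 𝒳 H₁) (z : H₁) :
    Continuous fun g : 𝒳.partition → Bool => M.blockProj {i | g i = true} z := by
  rw [continuous_iff_continuousAt]
  intro g₀
  rw [ContinuousAt, Metric.tendsto_nhds]
  intro ε hε
  obtain ⟨J, hJ⟩ := M.exists_finset_approx z (ε := ε / 3) (by positivity)
  have hev : ∀ᶠ g in 𝓝 g₀, ∀ i ∈ J, g i = g₀ i := by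
    rw [eventually_all_finset]
    intro i _
    have := (continuous_apply (A := fun _ : 𝒳.partition => Bool) i).tendsto g₀
    rw [nhds_discrete Bool, tendsto_pure] at this
    exact this
  filter_upwards [hev] with g hg
  have hz := hJ J subset_rfl
  have heq : M.blockProj {i | g i = true} (M.blockProj J z) =
      M.blockProj {i | g₀ i = true} (M.blockProj J z) := by
    rw [M.blockProj_comp, M.blockProj_comp]
    congr 2
    ext i
    simp only [Set.mem_inter_iff, Set.mem_ofPred_eq, Finset.mem_coe]
    exact and_congr_left fun hi => by rw [hg i hi]
  have hsub : M.blockProj {i | g i = true} z - M.blockProj {i | g₀ i = true} z =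
      M.blockProj {i | g i = true} (z - M.blockProj J z) -
        M.blockProj {i | g₀ i = true} (z - M.blockProj J z) := by
    rw [map_sub, map_sub, heq]; abel
  rw [dist_eq_norm, hsub]
  refine (norm_sub_le _ _).trans_lt ?_
  have h1 := M.norm_blockProj_le {i | g i = true} (z - M.blockProj J z)
  have h2 := M.norm_blockProj_le {i | g₀ i = true} (z - M.blockProj J z)
  linarith

/-- If all compressions of block projections are approximable, they are so uniformly: this is
a Baire category argument on the Cantor cube of subsets of the partition. -/
theorem exists_uniform_approxWithin (hY : 𝒴.coarse.IsCountablyGenerated)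
    (M : CoarseModule 𝒳 H₁) (N : CoarseModule 𝒴 H₂) (A : H₁ →L[ℂ] H₂) (B : H₂ →L[ℂ] H₁)
    (h : ∀ S, Approximable 𝒴 N.proj N.proj (A ∘L M.blockProj S ∘L B)) {ε : ℝ} (hε : 0 < ε) :
    ∃ G ∈ 𝒴.coarse.entourages, ∀ S, ApproxWithin N N G ε (A ∘L M.blockProj S ∘L B) := by
  classical
  obtain ⟨F, hFmono, hFmem, hFcof⟩ := hY.exists_cofinal
  have hn : ∀ S, ∃ n, ApproxWithin N N (F n) (ε / 3) (A ∘L M.blockProj S ∘L B) := by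
    intro S
    obtain ⟨G, hG, hGS⟩ := approximable_iff.1 (h S) (ε / 3) (by positivity)
    obtain ⟨n, hn⟩ := hFcof G hG
    exact ⟨n, hGS.mono hn le_rfl⟩
  choose n hn using hn
  let 𝒢 : ℕ → Set (𝒳.partition → Bool) := fun m =>
    {g | ApproxWithin N N (F m) (ε / 3) (A ∘L M.blockProj {i | g i = true} ∘L B)}
  have hclosed : ∀ m, IsClosed (𝒢 m) := by
    intro m
    rw [isClosed_iff_ultrafilter]
    intro g u hu hmem
    refine ApproxWithin.of_weak_limit (u := u) (R := ‖A‖ * (1 * ‖B‖))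
      (T := fun g => A ∘L M.blockProj {i | g i = true} ∘L B) ?_
      (Eventually.of_forall fun g => ?_) hmem
    · intro x y
      have h1 : Continuous fun g : 𝒳.partition → Bool =>
          inner ℂ (A (M.blockProj {i | g i = true} (B x))) y :=
        (A.continuous.comp (M.continuous_blockProj_apply (B x))).inner continuous_const
      exact (h1.tendsto g).mono_left hu
    · refine (opNorm_comp_le _ _).trans ?_
      gcongr
      refine (opNorm_comp_le _ _).trans ?_
      gcongr
      exact M.opNorm_blockProj_le _
  have hcover : ⋃ m, 𝒢 m = Set.univ := by
    refine Set.eq_univ_of_forall fun g => Set.mem_iUnion.2 ⟨n {i | g i = true}, hn _⟩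
  obtain ⟨m, g₀, hg₀⟩ := nonempty_interior_of_iUnion_of_closed hclosed hcover
  obtain ⟨J, v, hv, hJv⟩ := isOpen_pi_iff.1 isOpen_interior g₀ hg₀
  let m' := J.powerset.sup fun T => n (T : Set 𝒳.partition)
  have hsub : ∀ T : Set 𝒳.partition, T ⊆ J →
      ApproxWithin N N (F (max m m')) (ε / 3) (A ∘L M.blockProj T ∘L B) := by
    intro T hT
    obtain ⟨T', rfl⟩ : ∃ T' : Finset 𝒳.partition, (T' : Set 𝒳.partition) = T :=
      ⟨(J.finite_toSet.subset hT).toFinset, by simp⟩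
    refine (hn T').mono (hFmono (le_max_of_le_right ?_)) le_rfl
    exact Finset.le_sup (f := fun T : Finset 𝒳.partition => n (T : Set 𝒳.partition))
      (Finset.mem_powerset.2 (by exact_mod_cast hT))
  refine ⟨F (max m m'), hFmem _, fun S => ?_⟩
  let g : 𝒳.partition → Bool := fun i => if i ∈ J then g₀ i else decide (i ∈ S)
  let S' : Set 𝒳.partition := {i | g i = true}
  have hS' : ApproxWithin N N (F (max m m')) (ε / 3) (A ∘L M.blockProj S' ∘L B) := by
    have : g ∈ 𝒢 m := by
      refine interior_subset (hJv fun i hi => ?_)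
      have hi' : i ∈ J := hi
      simpa [g, hi'] using (hv i hi).2
    exact ApproxWithin.mono this (hFmono (le_max_left _ _)) le_rfl
  have hdiff : S' \ J = S \ J := by
    ext i
    by_cases hi : i ∈ J <;> simp [S', g, hi]
  have hsplit : ∀ (T : Set 𝒳.partition) (x : H₁),
      M.blockProj T x = M.blockProj (T \ J) x + M.blockProj (T ∩ J) x := by
    intro T x
    rw [← M.blockProj_union, Set.sdiff_union_inter]
    exact Set.disjoint_of_subset_right Set.inter_subset_right Set.disjoint_sdiff_left
  have key : A ∘L M.blockProj S ∘L B = A ∘L M.blockProj S' ∘L B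
      - A ∘L M.blockProj (S' ∩ J) ∘L B + A ∘L M.blockProj (S ∩ J) ∘L B := by
    ext x
    simp only [coe_comp, Function.comp_apply, add_apply, sub_apply]
    rw [hsplit S, hsplit S', hdiff]
    simp
  rw [key]
  refine ((hS'.sub (hsub _ Set.inter_subset_right)).add
    (hsub _ Set.inter_subset_right)).mono subset_rfl (by linarith)

end UniformApproximation

/-! ## Natural unitaries implementing a full and faithful *-functor -/

section NaturalUnitary

open ContinuousLinearMap InnerProductSpace

/-- An inner-product-preserving assignment on a total family extends to an isometry. -/
theorem exists_isometry_of_inner_eq [NormedAddCommGroup H₁] [InnerProductSpace ℂ H₁]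
    [NormedAddCommGroup H₂] [InnerProductSpace ℂ H₂] [CompleteSpace H₂] {ι : Type*}
    (v : ι → H₁) (w : ι → H₂) (h : ∀ i j, inner ℂ (w i) (w j) = inner ℂ (v i) (v j))
    (hd : Dense (Submodule.span ℂ (Set.range v) : Set H₁)) :
    ∃ U : H₁ →L[ℂ] H₂, (∀ i, U (v i) = w i) ∧ ∀ x, ‖U x‖ = ‖x‖ := by
  let e := Finsupp.linearCombination ℂ v
  let g := Finsupp.linearCombination ℂ w
  have hinner : ∀ x, inner ℂ (g x) (g x) = inner ℂ (e x) (e x) := by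
    intro x
    simp only [e, g, Finsupp.linearCombination_apply, Finsupp.sum, sum_inner, inner_sum,
      inner_smul_left, inner_smul_right, h]
  have hnorm : ∀ x, ‖g x‖ = ‖e x‖ := fun x => by
    rw [@norm_eq_sqrt_re_inner ℂ, @norm_eq_sqrt_re_inner ℂ, hinner]
  have hde : DenseRange e := by
    rw [DenseRange, ← LinearMap.coe_range, Finsupp.range_linearCombination]
    exact hd
  have hU : ∀ x, g.extendOfNorm e (e x) = g x :=
    LinearMap.extendOfNorm_eq hde ⟨1, fun x => by rw [hnorm, one_mul]⟩
  refine ⟨g.extendOfNorm e, fun i => ?_, fun x => ?_⟩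
  · have := hU (Finsupp.single i 1)
    simpa [e, g] using this
  · refine hde.induction_on (p := fun x => ‖g.extendOfNorm e x‖ = ‖x‖) x ?_ fun x => ?_
    · exact isClosed_eq (g.extendOfNorm e).continuous.norm continuous_norm
    · rw [hU, hnorm]

open Classical in
/-- The module with Hilbert space `V` concentrated at the point `a`. -/
def pointModule (𝒳 : LFCMSpace X) (a : X) (V : Type) [NormedAddCommGroup V]
    [InnerProductSpace ℂ V] [CompleteSpace V] : CoarseModule 𝒳 V where
  proj A := if a ∈ A then ContinuousLinearMap.id ℂ V else 0
  proj_empty := by simp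
  proj_selfAdjoint A _ := by
    split_ifs
    · exact IsSelfAdjoint.one (V →L[ℂ] V)
    · exact IsSelfAdjoint.zero _
  proj_inter {A B} _ _ := by
    by_cases hA : a ∈ A <;> by_cases hB : a ∈ B <;> simp [hA, hB]
  proj_union {A B} _ _ h := by
    by_cases hA : a ∈ A
    · have hB : a ∉ B := Set.disjoint_left.1 h hA
      simp [hA, hB]
    · simp [hA]
  nondeg := by
    obtain ⟨i, hi⟩ := 𝒳.exists_block a
    refine dense_univ.mono fun x _ => Submodule.subset_span ?_
    refine Set.mem_biUnion (x := (i : Set X))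
      ⟨𝒳.block_meas i, 𝒳.disc, 𝒳.disc_mem, 𝒳.block_prod_subset_disc i⟩ ⟨x, ?_⟩
    rw [if_pos hi]; rfl

variable {𝒳 : LFCMSpace X}

theorem pointModule_blockProj_of_mem {a : X} {V : Type} [NormedAddCommGroup V]
    [InnerProductSpace ℂ V] [CompleteSpace V] {i : 𝒳.partition} (h : a ∈ (i : Set X)) (x : V) :
    (pointModule 𝒳 a V).blockProj {i} x = x := by
  simp [CoarseModule.blockProj, pointModule, h]

theorem pointModule_blockProj_of_notMem {a : X} {V : Type} [NormedAddCommGroup V]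
    [InnerProductSpace ℂ V] [CompleteSpace V] {i : 𝒳.partition} (h : a ∉ (i : Set X)) (x : V) :
    (pointModule 𝒳 a V).blockProj {i} x = 0 := by
  simp [CoarseModule.blockProj, pointModule, h]

theorem isCtrl_pointModule [NormedAddCommGroup H₁] [InnerProductSpace ℂ H₁] [CompleteSpace H₁]
    [NormedAddCommGroup H₂] [InnerProductSpace ℂ H₂] [CompleteSpace H₂]
    {M : CoarseModule 𝒳 H₂} {a : X} {i k : 𝒳.partition} (hi : a ∈ (i : Set X))
    {t : H₁ →L[ℂ] H₂} (ht : ∀ x, M.blockProj {k} (t x) = t x) :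
    IsCtrl (pointModule 𝒳 a H₁) M ((k : Set X) ×ˢ (i : Set X)) t := by
  intro l j x hx
  have hj : a ∈ (j : Set X) := by
    by_contra h; apply hx; rw [pointModule_blockProj_of_notMem h]; simp
  obtain rfl := 𝒳.block_eq_of_mem hi hj
  have hl : l = k := by
    by_contra hlk; apply hx
    rw [← ht, M.blockProj_comp_of_disjoint (by simpa using hlk)]
  rw [hl]

theorem mem_entourages_of_pointModule_ne_zero [NormedAddCommGroup H₁] [InnerProductSpace ℂ H₁]
    [CompleteSpace H₁] [NormedAddCommGroup H₂] [InnerProductSpace ℂ H₂] [CompleteSpace H₂]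
    {a b : X} {t : H₁ →L[ℂ] H₂}
    (ht : Approximable 𝒳 (pointModule 𝒳 a H₁).proj (pointModule 𝒳 b H₂).proj t) (h : t ≠ 0) :
    {(b, a)} ∈ 𝒳.coarse.entourages := by
  obtain ⟨G, hG, c, hc, htc⟩ := approximable_iff.1 ht (‖t‖ / 2) (by positivity)
  refine 𝒳.coarse.mem_of_subset hG (Set.singleton_subset_iff.2 ?_)
  have hc0 : c ≠ 0 := by
    rintro rfl
    rw [sub_zero] at htc
    have := norm_pos_iff.2 h
    linarith
  obtain ⟨x, hx⟩ := DFunLike.ne_iff.1 hc0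
  obtain ⟨i, hi⟩ := 𝒳.exists_block a
  obtain ⟨k, hk⟩ := 𝒳.exists_block b
  refine hc k i x ?_ (Set.mk_mem_prod hk hi)
  rw [pointModule_blockProj_of_mem hi, pointModule_blockProj_of_mem hk]
  exact hx

namespace StarFunctor

variable {𝒴 : LFCMSpace Y} (F : StarFunctor 𝒳 𝒴)

theorem map_congr {C D : BundledModule 𝒳} {s t : C.H →L[ℂ] D.H} (h : s = t)
    (hs : Approximable 𝒳 C.mod.proj D.mod.proj s) (ht : Approximable 𝒳 C.mod.proj D.mod.proj t) :
    F.map s hs = F.map t ht := by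
  subst h; rfl

theorem map_zero {C D : BundledModule 𝒳}
    (h : Approximable 𝒳 C.mod.proj D.mod.proj (0 : C.H →L[ℂ] D.H)) : F.map 0 h = 0 := by
  have := F.map_smul 0 (0 : C.H →L[ℂ] D.H) h (by simpa using h)
  rw [zero_smul ℂ (F.map 0 h)] at this
  rw [← this]
  exact F.map_congr (by simp) _ _

variable {F}

theorem Faithful.eq_zero (hF : F.Faithful) {C D : BundledModule 𝒳} {t : C.H →L[ℂ] D.H}
    (ht : Approximable 𝒳 C.mod.proj D.mod.proj t) (h : F.map t ht = 0) : t = 0 :=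
  hF C D t 0 ht approximable_zero (by rw [h, map_zero])

theorem Faithful.exists_unit_vector (hF : F.Faithful) (C : BundledModule 𝒳) [Nontrivial C.H] :
    ∃ w : (F.obj C).H, ‖w‖ = 1 := by
  have : Nontrivial (F.obj C).H := by
    by_contra h
    rw [not_nontrivial_iff_subsingleton] at h
    have h1 := hF.eq_zero (C := C) (D := C) approximable_id (by ext x; exact Subsingleton.elim _ _)
    obtain ⟨x, hx⟩ := exists_ne (0 : C.H)
    exact hx (congrArg (fun s => s x) h1)
  exact exists_norm_eq (F.obj C).H zero_le_one

/-- A full and faithful *-functor is spatially implemented by a natural family of unitaries. -/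
theorem exists_natural_unitary (hfull : F.Full) (hF : F.Faithful) :
    ∃ η : ∀ C : BundledModule 𝒳, C.H →L[ℂ] (F.obj C).H, (∀ C, IsUnitaryOp (η C)) ∧
      ∀ (C D : BundledModule 𝒳) (t : C.H →L[ℂ] D.H)
        (ht : Approximable 𝒳 C.mod.proj D.mod.proj t), F.map t ht ∘L η C = η D ∘L t := by
  let rel : Setoid X :=
    { r := fun a b => {(a, b)} ∈ 𝒳.coarse.entourages
      iseqv :=
        { refl := fun a => 𝒳.coarse.mem_of_subset 𝒳.coarse.diagonal_mem (by simp)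
          symm := fun {a b} h => 𝒳.coarse.mem_of_subset (𝒳.coarse.transpose_mem h)
            (by simp [RelTrans])
          trans := fun {a b c} h h' => 𝒳.coarse.mem_of_subset (𝒳.coarse.comp_mem h h')
            (by simp [RelComp]) } }
  let rep : X → X := fun a => (Quotient.mk rel a).out
  have hrep : ∀ a, {(a, rep a)} ∈ 𝒳.coarse.entourages := fun a =>
    rel.symm (Quotient.mk_out (s := rel) a)
  have hrep_eq : ∀ {a b}, {(a, b)} ∈ 𝒳.coarse.entourages → rep a = rep b := fun {a b} h =>
    congrArg Quotient.out (Quotient.sound (s := rel) h)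
  let pt : X → BundledModule 𝒳 := fun a => ⟨ℂ, pointModule 𝒳 a ℂ⟩
  choose w hw using fun a => (haveI : Nontrivial (pt a).H := inferInstanceAs (Nontrivial ℂ);
    hF.exists_unit_vector (pt a))
  let ket : ∀ (C : BundledModule 𝒳), C.H → (ℂ →L[ℂ] C.H) := fun C z => toSpanSingleton ℂ z
  let ι : BundledModule 𝒳 → Type := fun C =>
    {p : X × C.H // rep p.1 = p.1 ∧ Approximable 𝒳 (pt p.1).mod.proj C.mod.proj (ket C p.2)}
  let W : ∀ C, ι C → (F.obj C).H := fun C p =>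
    F.map (C := pt p.1.1) (D := C) (ket C p.1.2) p.2.2 (w p.1.1)
  have hinner : ∀ C (p q : ι C), inner ℂ (W C p) (W C q) = inner ℂ p.1.2 q.1.2 := by
    rintro C ⟨⟨a, z⟩, ha, hz⟩ ⟨⟨b, z'⟩, hb, hz'⟩
    simp only at ha hz hb hz'
    have hs : Approximable 𝒳 (pt b).mod.proj (pt a).mod.proj
      (ContinuousLinearMap.adjoint (ket C z) ∘L ket C z') := hz.adjoint'.comp' hz'
    have h1 : inner ℂ (W C ⟨⟨a, z⟩, ha, hz⟩) (W C ⟨⟨b, z'⟩, hb, hz'⟩) =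
        inner ℂ (w a) (F.map (C := pt b) (D := pt a) _ hs (w b)) := by
      rw [F.map_comp (C := pt b) (D := C) (G := pt a) _ _ hz' hz.adjoint' hs,
        F.map_star (C := pt a) (D := C) _ hz, comp_apply, adjoint_inner_right]
    have h2 : ContinuousLinearMap.adjoint (ket C z) ∘L ket C z' =
        inner ℂ z z' • ContinuousLinearMap.id ℂ ℂ := by
      ext
      simp [ket, ContinuousLinearMap.adjoint_toSpanSingleton]
    rw [h1]
    by_cases hab : a = b
    · subst hab
      have h3 : F.map (C := pt a) (D := pt a) _ hs =
          inner ℂ z z' • ContinuousLinearMap.id ℂ (F.obj (pt a)).H := by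
        rw [← F.map_id (pt a) approximable_id]
        exact (F.map_congr h2 hs (approximable_id.smul' _)).trans
          (F.map_smul (C := pt a) (D := pt a) _ _ approximable_id _)
      rw [h3, smul_apply, id_apply, inner_smul_right, inner_self_eq_norm_sq_to_K, hw]
      simp
    · have h3 : ContinuousLinearMap.adjoint (ket C z) ∘L ket C z' = 0 := by
        by_contra h0
        have := hrep_eq (mem_entourages_of_pointModule_ne_zero hs h0)
        rw [ha, hb] at this
        exact hab this
      have h4 : inner ℂ z z' = 0 := by
        have := congrArg (fun s : ℂ →L[ℂ] ℂ => s 1) (h2.symm.trans h3)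
        simpa using this
      have h5 : F.map (C := pt b) (D := pt a) _ hs = 0 := by
        rw [← F.map_zero (C := pt b) (D := pt a) approximable_zero]
        exact F.map_congr h3 _ _
      rw [h4, h5, zero_apply, inner_zero_right]
  have hblock : ∀ (C : BundledModule 𝒳) (i : 𝒳.partition) (z : C.H),
      ∃ p : ι C, p.1.2 = C.mod.blockProj {i} z := by
    intro C i z
    obtain ⟨a, ha⟩ := 𝒳.block_nonempty i
    obtain ⟨j, hj⟩ := 𝒳.exists_block (rep a)
    have hctrl : IsCtrl (pointModule 𝒳 (rep a) ℂ) C.mod ((i : Set X) ×ˢ (j : Set X))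
        (ket C (C.mod.blockProj {i} z)) :=
      isCtrl_pointModule hj fun x => by simp [ket]
    refine ⟨⟨(rep a, C.mod.blockProj {i} z), (hrep_eq (hrep a)).symm, hctrl.approximable ?_⟩, rfl⟩
    refine 𝒳.coarse.mem_of_subset (𝒳.coarse.comp_mem 𝒳.disc_mem
      (𝒳.coarse.comp_mem (hrep a) 𝒳.disc_mem)) ?_
    rintro ⟨x, y⟩ ⟨hx, hy⟩
    exact ⟨a, 𝒳.block_prod_subset_disc i ⟨hx, ha⟩, rep a, rfl, 𝒳.block_prod_subset_disc j ⟨hj, hy⟩⟩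
  have hdense : ∀ C : BundledModule 𝒳,
      Dense (Submodule.span ℂ (Set.range fun p : ι C => p.1.2) : Set C.H) := by
    intro C
    refine C.mod.dense_span_blocks.mono (Submodule.span_mono ?_)
    refine Set.iUnion_subset fun i => ?_
    rintro _ ⟨z, rfl⟩
    obtain ⟨p, hp⟩ := hblock C i z
    exact ⟨p, hp⟩
  choose η hη hηnorm using fun C => exists_isometry_of_inner_eq _ (W C) (hinner C) (hdense C)
  have hnat : ∀ (C D : BundledModule 𝒳) (t : C.H →L[ℂ] D.H)
        (ht : Approximable 𝒳 C.mod.proj D.mod.proj t), F.map t ht ∘L η C = η D ∘L t := by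
    intro C D t ht
    refine ContinuousLinearMap.ext_on (hdense C) ?_
    rintro _ ⟨⟨⟨a, z⟩, ha, hz⟩, rfl⟩
    have hk : t ∘L ket C z = ket D (t z) := by ext; simp [ket]
    have htz : Approximable 𝒳 (pt a).mod.proj D.mod.proj (ket D (t z)) := hk ▸ ht.comp' hz
    have h1 := hη C ⟨⟨a, z⟩, ha, hz⟩
    have h2 := hη D ⟨⟨a, t z⟩, ha, htz⟩
    simp only [comp_apply] at h1 h2 ⊢
    rw [h1, h2]
    have h3 := F.map_comp (C := pt a) (D := C) (G := D) (ket C z) t hz ht (ht.comp' hz)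
    have h4 := F.map_congr (C := pt a) (D := D) hk (ht.comp' hz) htz
    rw [h4] at h3
    exact (congrArg (fun s => s (w a)) h3).symm
  refine ⟨η, fun C => ?_, hnat⟩
  have hiso : ContinuousLinearMap.adjoint (η C) ∘L η C = ContinuousLinearMap.id ℂ C.H :=
    (norm_map_iff_adjoint_comp_self (η C)).1 (hηnorm C)
  refine ⟨hiso, ?_⟩
  refine (F.obj C).mod.ext_blocks fun k z => ?_
  set y := (F.obj C).mod.blockProj {k} z with hy
  suffices hyr : ∃ x, η C x = y by
    obtain ⟨x, hx⟩ := hyr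
    rw [← hx]
    have := congrArg (fun s => s x) hiso
    simp only [comp_apply, id_apply] at this
    simp [this]
  by_cases hy0 : y = 0
  · exact ⟨0, by simp [hy0]⟩
  have hyk : (F.obj C).mod.blockProj {k} y = y := by simp [hy]
  have hctrl : IsCtrl (F.obj C).mod (F.obj C).mod 𝒴.disc (rankOne ℂ y y) :=
    IsCtrl.rankOne hyk hyk (by
      intro a ha b hb
      rw [Set.mem_singleton_iff.1 ha, Set.mem_singleton_iff.1 hb]
      exact 𝒴.block_prod_subset_disc k)
  obtain ⟨p, hp, hpy⟩ := hfull C C _ (hctrl.approximable 𝒴.disc_mem)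
  have hn := hnat C C p hp
  have hex : ∃ x, inner ℂ y (η C x) ≠ 0 := by
    by_contra hall
    push Not at hall
    have hp0 : p = 0 := by
      ext x
      rw [zero_apply, ← norm_eq_zero, ← hηnorm, norm_eq_zero]
      have := congrArg (fun s => s x) hn
      simp only [comp_apply] at this
      rw [← this, hpy, rankOne_apply, hall x, zero_smul]
    have h0 : F.map p hp = 0 := by
      rw [← F.map_zero (C := C) (D := C) approximable_zero]
      exact F.map_congr hp0 _ _
    rw [hpy] at h0
    have := congrArg (fun s => s y) h0
    simp only [rankOne_apply, zero_apply, smul_eq_zero, inner_self_eq_zero, or_self] at this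
    exact hy0 this
  obtain ⟨x, hx⟩ := hex
  refine ⟨(inner ℂ y (η C x))⁻¹ • p x, ?_⟩
  have := congrArg (fun s => s x) hn
  simp only [comp_apply] at this
  rw [_root_.map_smul, ← this, hpy, rankOne_apply, smul_smul, inv_mul_cancel₀ hx, one_smul]

end StarFunctor

end NaturalUnitary

/-! ## Concentration of vectors -/

section Concentration

open ContinuousLinearMap InnerProductSpace Filter Topology

variable [NormedAddCommGroup H₀] [InnerProductSpace ℂ H₀] [CompleteSpace H₀]
variable [NormedAddCommGroup H₁] [InnerProductSpace ℂ H₁] [CompleteSpace H₁]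
variable [NormedAddCommGroup H₂] [InnerProductSpace ℂ H₂] [CompleteSpace H₂]
variable {𝒳 : LFCMSpace X}

/-- The partial isometry mapping one orthonormal sequence to another, as a strongly convergent
series of rank-one operators. -/
theorem exists_hasSum_rankOne {v : ℕ → H₁} {w : ℕ → H₂} (hv : Orthonormal ℂ v)
    (hw : Orthonormal ℂ w) :
    ∃ t : H₁ →L[ℂ] H₂, ∀ x, HasSum (fun n => rankOne ℂ (w n) (v n) x) (t x) := by
  let V := hv.orthogonalFamily.linearIsometry
  let W := hw.orthogonalFamily.linearIsometry
  refine ⟨W.toContinuousLinearMap ∘L ContinuousLinearMap.adjoint V.toContinuousLinearMap,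
    fun x => ?_⟩
  have h := hw.orthogonalFamily.hasSum_linearIsometry
    (ContinuousLinearMap.adjoint V.toContinuousLinearMap x)
  change HasSum _ (hw.orthogonalFamily.linearIsometry
    (ContinuousLinearMap.adjoint V.toContinuousLinearMap x))
  convert h using 2 with n
  have h1 : inner ℂ (lp.single 2 n (1 : ℂ) : lp (fun _ : ℕ => ℂ) 2)
      (ContinuousLinearMap.adjoint V.toContinuousLinearMap x) = inner ℂ (v n) x := by
    rw [adjoint_inner_right]
    congr 1
    simp [V]
  rw [lp.inner_single_left] at h1
  simp only [rankOne_apply, LinearIsometry.toSpanSingleton_apply]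
  rw [← h1]
  simp

theorem HasSum.isCtrl {M : CoarseModule 𝒳 H₁} {N : CoarseModule 𝒳 H₂} {G : Set (X × X)}
    {c : ℕ → H₁ →L[ℂ] H₂} {t : H₁ →L[ℂ] H₂} (ht : ∀ x, HasSum (fun n => c n x) (t x))
    (hc : ∀ n, IsCtrl M N G (c n)) : IsCtrl M N G t := by
  intro k i x hx
  by_contra hki
  apply hx
  have h := (ht (M.blockProj {i} x)).mapL (N.blockProj {k})
  have h0 : ∀ n, N.blockProj {k} (c n (M.blockProj {i} x)) = 0 := fun n => by
    by_contra h0; exact hki (hc n k i x h0)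
  simp only [h0] at h
  exact h.unique hasSum_zero

theorem CoarseModule.norm_blockProj_mono (M : CoarseModule 𝒳 H₁) {S T : Set 𝒳.partition}
    (h : S ⊆ T) (x : H₁) : ‖M.blockProj S x‖ ≤ ‖M.blockProj T x‖ := by
  rw [← M.blockProj_comp_of_subset h]
  exact M.norm_blockProj_le _ _

theorem LFCMSpace.near_relComp {G G' : Set (X × X)} {b : X} {k j : 𝒳.partition}
    (hk : (k : Set X) ×ˢ (j : Set X) ⊆ G) (hj : j ∈ 𝒳.near G' b) :
    k ∈ 𝒳.near (RelComp G G') b := by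
  rintro ⟨x, _⟩ ⟨hx, rfl⟩
  obtain ⟨y, hy⟩ := 𝒳.block_nonempty j
  exact ⟨y, hk ⟨hx, hy⟩, hj ⟨hy, rfl⟩⟩

/-- If a rank-one operator is almost controlled and its source vector is partly concentrated
near a point, then its range vector is concentrated near that point. -/
theorem ApproxWithin.norm_blockProj_compl_le {M : CoarseModule 𝒳 H₁} {N : CoarseModule 𝒳 H₂}
    {G G₀ : Set (X × X)} {ε : ℝ} {x : H₂} {y : H₁} {b : X}
    (h : ApproxWithin M N G ε (rankOne ℂ x y)) (hy : 1 / 2 ≤ ‖M.blockProj (𝒳.near G₀ b) y‖) :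
    ‖N.blockProj (𝒳.near (RelComp G G₀) b)ᶜ x‖ ≤ 2 * ε := by
  obtain ⟨c, hc, hcε⟩ := h
  set z := M.blockProj (𝒳.near G₀ b) y with hz
  set Q := N.blockProj (𝒳.near (RelComp G G₀) b)ᶜ
  have h1 : inner ℂ y z = (‖z‖ : ℂ) ^ 2 := by
    have hzz : M.blockProj (𝒳.near G₀ b) z = z := M.blockProj_idem _ _
    rw [← hzz, ← M.inner_blockProj_left, hzz, ← hz, inner_self_eq_norm_sq_to_K]
    rfl
  have h2 : Q (c z) = 0 := by
    rw [hz]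
    refine hc.blockProj_apply_eq_zero ?_ _
    intro k hk j hj hkj
    exact hk (LFCMSpace.near_relComp hkj hj)
  have h3 : (‖z‖ : ℂ) ^ 2 • Q x = Q ((rankOne ℂ x y - c) z) := by
    rw [sub_apply, map_sub, h2, sub_zero, rankOne_apply, h1, map_smul]
  have h4 : ‖z‖ ^ 2 * ‖Q x‖ ≤ ε * ‖z‖ := by
    calc ‖z‖ ^ 2 * ‖Q x‖ = ‖(‖z‖ : ℂ) ^ 2 • Q x‖ := by simp [norm_smul]
      _ ≤ ‖(rankOne ℂ x y - c) z‖ := by rw [h3]; exact N.norm_blockProj_le _ _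
      _ ≤ ε * ‖z‖ := (rankOne ℂ x y - c).le_of_opNorm_le hcε z
  have h5 : 0 < ‖z‖ := by linarith
  have h6 : ‖z‖ * ‖Q x‖ ≤ ε := by
    refine le_of_mul_le_mul_right ?_ h5
    linarith
  nlinarith [norm_nonneg (Q x)]

theorem orthonormal_of_blocks {M : CoarseModule 𝒳 H₁} {v : ℕ → H₁} {S : ℕ → Set 𝒳.partition}
    (hv : ∀ n, ‖v n‖ = 1) (hS : ∀ n, M.blockProj (S n) (v n) = v n)
    (hd : ∀ m n, m < n → Disjoint (S m) (S n)) : Orthonormal ℂ v := by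
  refine ⟨hv, fun m n hmn => ?_⟩
  have hdis : Disjoint (S m) (S n) := by
    rcases lt_or_gt_of_ne hmn with h | h
    · exact hd m n h
    · exact (hd n m h).symm
  change inner ℂ (v m) (v n) = 0
  rw [← hS m, ← hS n, M.inner_blockProj_left, M.blockProj_comp_of_disjoint hdis, inner_zero_right]

theorem LFCMSpace.finite_setOf_prod_subset {G : Set (X × X)} (hG : G ∈ 𝒳.coarse.entourages)
    (j : 𝒳.partition) : {k : 𝒳.partition | (k : Set X) ×ˢ (j : Set X) ⊆ G}.Finite := by
  obtain ⟨b, hb⟩ := 𝒳.block_nonempty j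
  refine (𝒳.near_finite hG b).subset fun k hk => ?_
  rintro ⟨x, _⟩ ⟨hx, rfl⟩
  exact hk ⟨hx, hb⟩

theorem LFCMSpace.finite_setOf_prod_subset' {G : Set (X × X)} (hG : G ∈ 𝒳.coarse.entourages)
    (k : 𝒳.partition) : {j : 𝒳.partition | (k : Set X) ×ˢ (j : Set X) ⊆ G}.Finite := by
  refine (LFCMSpace.finite_setOf_prod_subset (𝒳.coarse.transpose_mem hG) k).subset fun j hj => ?_
  rintro ⟨x, y⟩ ⟨hx, hy⟩
  exact hj ⟨hy, hx⟩

/-- If all operators on a module over a countably generated space are approximable, the module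
is supported on finitely many blocks. -/
theorem exists_finset_blockProj_eq_self (hX : 𝒳.coarse.IsCountablyGenerated)
    (M : CoarseModule 𝒳 H₁) (h : ∀ t : H₁ →L[ℂ] H₁, Approximable 𝒳 M.proj M.proj t) :
    ∃ J : Set 𝒳.partition, J.Finite ∧ ∀ x, M.blockProj J x = x := by
  by_cases hB : {k : 𝒳.partition | ∃ x, M.blockProj {k} x ≠ 0}.Finite
  · refine ⟨_, hB, fun x => ?_⟩
    have : M.blockProj {k : 𝒳.partition | ∃ x, M.blockProj {k} x ≠ 0} =
        ContinuousLinearMap.id ℂ H₁ := by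
      refine M.ext_blocks fun k x => ?_
      by_cases hk : M.blockProj {k} x = 0
      · rw [hk]; simp
      · exact M.blockProj_comp_of_subset' (by simpa using ⟨x, hk⟩) x
    rw [this]; rfl
  exfalso
  obtain ⟨F, hFmono, hFmem, hFcof⟩ := hX.exists_cofinal
  obtain ⟨g, hg, hgr⟩ := exists_seq_of_forall_finset_exists
    (fun p : ℕ × 𝒳.partition => ∃ x, M.blockProj {p.2} x ≠ 0)
    (fun p q => p.1 < q.1 ∧ p.2 ≠ q.2 ∧ ¬ (p.2 : Set X) ×ˢ (q.2 : Set X) ⊆ F q.1) (by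
      intro s _
      obtain ⟨n, hn⟩ : ∃ n, ∀ p ∈ s, p.1 < n := by
        obtain ⟨n, hn⟩ := (s.image Prod.fst).exists_le
        exact ⟨n + 1, fun p hp => Nat.lt_succ_of_le (hn _ (Finset.mem_image_of_mem _ hp))⟩
      have hfin : (⋃ p ∈ s, ({p.2} ∪
          {j : 𝒳.partition | (p.2 : Set X) ×ˢ (j : Set X) ⊆ F n})).Finite :=
        s.finite_toSet.biUnion fun p _ =>
          (Set.finite_singleton _).union (LFCMSpace.finite_setOf_prod_subset' (hFmem n) _)
      obtain ⟨k, hk, hk'⟩ := (Set.not_subset.1 fun hsub => hB (hfin.subset hsub))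
      simp only [Set.mem_iUnion, not_exists, Set.mem_union, not_or] at hk'
      exact ⟨(n, k), hk, fun p hp => ⟨hn p hp, fun h => (hk' p hp).1 h.symm, (hk' p hp).2⟩⟩)
  have hz : ∀ n, ∃ z : H₁, ‖z‖ = 1 ∧ M.blockProj {(g n).2} z = z := by
    intro n
    obtain ⟨x, hx⟩ := hg n
    refine ⟨(‖M.blockProj {(g n).2} x‖⁻¹ : ℂ) • M.blockProj {(g n).2} x, ?_, by simp⟩
    rw [norm_smul]
    have : ‖M.blockProj {(g n).2} x‖ ≠ 0 := norm_ne_zero_iff.2 hx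
    simp [this]
  choose z hz1 hz using hz
  have ho : Orthonormal ℂ z := orthonormal_of_blocks hz1 hz fun m n hmn => by
    simpa using (hgr m n hmn).2.1
  obtain ⟨t, ht⟩ := exists_hasSum_rankOne (ho.comp _ Nat.succ_injective) ho
  have htz : ∀ n, t (z (n + 1)) = z n := by
    intro n
    refine (ht (z (n + 1))).unique ?_
    convert hasSum_single n ?_ using 1
    · simp [hz1]
    · intro m hm
      have : inner ℂ (z (m + 1)) (z (n + 1)) = 0 := ho.2 (by simpa using hm)
      simp [this]
  obtain ⟨G, hG, c, hc, htc⟩ := approximable_iff.1 (h t) (1 / 2) (by norm_num)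
  obtain ⟨n, hn⟩ := hFcof G hG
  have hgn : ∀ n, n ≤ (g n).1 := fun n =>
    (strictMono_nat_of_lt_succ (f := fun n => (g n).1) fun n =>
    (hgr n (n + 1) (Nat.lt_succ_self n)).1).le_apply
  have h0 : M.blockProj {(g n).2} (c (z (n + 1))) = 0 := by
    rw [← hz (n + 1)]
    by_contra h0
    refine (hgr n (n + 1) (Nat.lt_succ_self n)).2.2 ((hc _ _ _ h0).trans ?_)
    exact hn.trans (hFmono ((Nat.le_succ n).trans (hgn (n + 1))))
  have h1 : z n = M.blockProj {(g n).2} ((t - c) (z (n + 1))) := by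
    rw [sub_apply, map_sub, h0, htz, hz, sub_zero]
  have h2 : ‖z n‖ ≤ 1 / 2 := by
    rw [h1]
    refine (M.norm_blockProj_le _ _).trans ?_
    simpa [hz1] using (t - c).le_of_opNorm_le htc (z (n + 1))
  rw [hz1] at h2
  norm_num at h2

end Concentration

/-! ## Natural implementations of a *-functor -/

section Implementation

open ContinuousLinearMap InnerProductSpace Filter Topology

/-- A natural family of unitaries implementing a *-functor on all approximable operators. -/
structure StarFunctor.Implementation {𝒳 : LFCMSpace X} {𝒴 : LFCMSpace Y}
    (F : StarFunctor 𝒳 𝒴) where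
  op : ∀ C : BundledModule 𝒳, C.H →L[ℂ] (F.obj C).H
  isUnitaryOp : ∀ C, IsUnitaryOp (op C)
  natural : ∀ (C D : BundledModule 𝒳) (t : C.H →L[ℂ] D.H)
    (ht : Approximable 𝒳 C.mod.proj D.mod.proj t), F.map t ht ∘L op C = op D ∘L t

namespace StarFunctor.Implementation

variable {𝒳 : LFCMSpace X} {𝒴 : LFCMSpace Y} {F : StarFunctor 𝒳 𝒴} (η : F.Implementation)
variable {C D : BundledModule 𝒳}

@[simp] theorem adjoint_op_apply (x : C.H) : ContinuousLinearMap.adjoint (η.op C) (η.op C x) = x :=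
  DFunLike.congr_fun (η.isUnitaryOp C).1 x

@[simp] theorem op_adjoint_apply (x : (F.obj C).H) :
    η.op C (ContinuousLinearMap.adjoint (η.op C) x) = x :=
  DFunLike.congr_fun (η.isUnitaryOp C).2 x

theorem inner_op (x y : C.H) : inner ℂ (η.op C x) (η.op C y) = inner ℂ x y := by
  rw [← ContinuousLinearMap.adjoint_inner_left, adjoint_op_apply]

@[simp] theorem norm_op (x : C.H) : ‖η.op C x‖ = ‖x‖ := by
  rw [norm_eq_sqrt_re_inner (𝕜 := ℂ), η.inner_op, ← norm_eq_sqrt_re_inner (𝕜 := ℂ)]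

/-- Conjugation of an operator by the implementing unitaries. -/
def conj (t : C.H →L[ℂ] D.H) : (F.obj C).H →L[ℂ] (F.obj D).H :=
  η.op D ∘L t ∘L ContinuousLinearMap.adjoint (η.op C)

theorem conj_apply (t : C.H →L[ℂ] D.H) (x : (F.obj C).H) :
    η.conj t x = η.op D (t (ContinuousLinearMap.adjoint (η.op C) x)) := rfl

@[simp] theorem conj_op (t : C.H →L[ℂ] D.H) (x : C.H) : η.conj t (η.op C x) = η.op D (t x) := by
  simp [conj_apply]

theorem map_eq_conj (t : C.H →L[ℂ] D.H) (ht : Approximable 𝒳 C.mod.proj D.mod.proj t) :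
    F.map t ht = η.conj t := by
  ext x
  have := DFunLike.congr_fun (η.natural C D t ht) (ContinuousLinearMap.adjoint (η.op C) x)
  simpa [conj_apply] using this

theorem approximable_conj {t : C.H →L[ℂ] D.H} (ht : Approximable 𝒳 C.mod.proj D.mod.proj t) :
    Approximable 𝒴 (F.obj C).mod.proj (F.obj D).mod.proj (η.conj t) := by
  rw [← η.map_eq_conj t ht]
  exact F.map_approximable t ht

theorem conj_rankOne (x : D.H) (y : C.H) :
    η.conj (rankOne ℂ x y) = rankOne ℂ (η.op D x) (η.op C y) := by
  ext z
  simp [conj_apply, rankOne_apply, ContinuousLinearMap.adjoint_inner_right]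

theorem implements (C : BundledModule 𝒳) : F.Implements C (η.op C) :=
  ⟨η.isUnitaryOp C, fun t ht => η.map_eq_conj t ht⟩

theorem exists_uniform_conj_blockProj (hY : 𝒴.coarse.IsCountablyGenerated) (C : BundledModule 𝒳)
    {ε : ℝ} (hε : 0 < ε) :
    ∃ G ∈ 𝒴.coarse.entourages, ∀ S, ApproxWithin (F.obj C).mod (F.obj C).mod G ε
      (η.conj (C.mod.blockProj S)) :=
  exists_uniform_approxWithin hY C.mod (F.obj C).mod (η.op C)
    (ContinuousLinearMap.adjoint (η.op C))
    (fun S => η.approximable_conj (approximable_blockProj S)) hε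

/-- A system of unit vectors in a module over the source, concentrated near every point `a`,
whose images are partly concentrated near `f a`. -/
structure Anchors (f : X → Y) (C : BundledModule 𝒳) where
  E : Set (X × X)
  E_mem : E ∈ 𝒳.coarse.entourages
  G : Set (Y × Y)
  G_mem : G ∈ 𝒴.coarse.entourages
  vec : X → C.H
  norm_vec : ∀ a, ‖vec a‖ = 1
  blockProj_vec : ∀ a, C.mod.blockProj (𝒳.near E a) (vec a) = vec a
  half_le : ∀ a, 1 / 2 ≤ ‖(F.obj C).mod.blockProj (𝒴.near G (f a)) (η.op C (vec a))‖

theorem _root_.LFCMSpace.subset_blockUnion_near {𝒵 : LFCMSpace Z} {A : Set Z} {E₀ E₁ : Set (Z × Z)}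
    {a x : Z} (hA : A ×ˢ A ⊆ E₀) (hx : x ∈ A) (hax : (a, x) ∈ E₁) :
    A ⊆ 𝒵.blockUnion (𝒵.near (RelComp (RelComp 𝒵.disc E₀) (RelTrans E₁)) a) := by
  intro z hz
  obtain ⟨i, hi⟩ := 𝒵.exists_block z
  refine 𝒵.mem_blockUnion.2 ⟨i, ?_, hi⟩
  rintro ⟨w, _⟩ ⟨hw, rfl⟩
  exact ⟨x, ⟨z, 𝒵.block_prod_subset_disc i ⟨hw, hi⟩, hA ⟨hz, hx⟩⟩, hax⟩

theorem exists_anchors {f : X → Y} (hrep : RepresentsInducedEmbedding F f)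
    (hC : IsFaithfulMod 𝒳 C.mod) : Nonempty (η.Anchors f C) := by
  obtain ⟨F₀, hF₀, E₀, hE₀, h⟩ := hrep C hC (η.op C) (η.implements C) (1 / 2) (by norm_num)
    (by norm_num)
  obtain ⟨F₁, hF₁, E₁, hE₁, h⟩ := (h F₀ hF₀ subset_rfl E₀ hE₀ subset_rfl).2
  have key : ∀ a, ∃ y : C.H, ‖y‖ = 1 ∧
      C.mod.blockProj (𝒳.near (RelComp (RelComp 𝒳.disc E₀) (RelTrans E₁)) a) y = y ∧
      1 / 2 ≤ ‖(F.obj C).mod.blockProj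
        (𝒴.near (RelComp (RelComp 𝒴.disc F₀) (RelTrans F₁)) (f a)) (η.op C y)‖ := by
    intro a
    obtain ⟨⟨y', x'⟩, ⟨_, ⟨B, A, rfl, hB, hBF, hA, hAE, hBA⟩, hy', hx'⟩, hy1, hx1⟩ :=
      h (f a, a) rfl
    have hAs := LFCMSpace.subset_blockUnion_near (𝒵 := 𝒳) hAE hx' hx1
    have hBs := LFCMSpace.subset_blockUnion_near (𝒵 := 𝒴) hBF hy' hy1
    obtain ⟨z, hz⟩ : ∃ z, 1 / 2 * ‖z‖ < ‖(F.obj C).mod.proj B (η.op C (C.mod.proj A z))‖ := by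
      by_contra hcon
      push Not at hcon
      exact absurd (ContinuousLinearMap.opNorm_le_bound _ (by norm_num) hcon) (not_le.2 hBA)
    have hz0 : C.mod.proj A z ≠ 0 := by
      intro h0
      rw [h0, _root_.map_zero, _root_.map_zero, norm_zero] at hz
      linarith [norm_nonneg z]
    have hn : ‖C.mod.proj A z‖ ≠ 0 := norm_ne_zero_iff.2 hz0
    refine ⟨(‖C.mod.proj A z‖⁻¹ : ℂ) • C.mod.proj A z, ?_, ?_, ?_⟩
    · rw [norm_smul]; simp [hn]
    · rw [_root_.map_smul]
      congr 1
      exact C.mod.proj_of_subset hA (𝒳.blockUnion_meas _) hAs z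
    · rw [_root_.map_smul, _root_.map_smul, norm_smul]
      have h1 : ‖(F.obj C).mod.proj B (η.op C (C.mod.proj A z))‖ ≤
          ‖(F.obj C).mod.blockProj
        (𝒴.near (RelComp (RelComp 𝒴.disc F₀) (RelTrans F₁)) (f a)) (η.op C (C.mod.proj A z))‖ := by
        rw [← (F.obj C).mod.proj_of_subset' hB (𝒴.blockUnion_meas _) hBs]
        exact (F.obj C).mod.norm_proj_le hB _
      have h2 := C.mod.norm_proj_le hA z
      have h3 : 0 < ‖C.mod.proj A z‖ := norm_pos_iff.2 hz0
      simp only [norm_inv, Complex.norm_real, norm_norm]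
      rw [inv_mul_eq_div, le_div_iff₀ h3]
      nlinarith
  choose y hy1 hy2 hy3 using key
  exact ⟨⟨_, 𝒳.coarse.comp_mem (𝒳.coarse.comp_mem 𝒳.disc_mem hE₀) (𝒳.coarse.transpose_mem hE₁),
    _, 𝒴.coarse.comp_mem (𝒴.coarse.comp_mem 𝒴.disc_mem hF₀) (𝒴.coarse.transpose_mem hF₁),
    y, hy1, hy2, hy3⟩⟩

end StarFunctor.Implementation

end Implementation

section Displacement

open ContinuousLinearMap InnerProductSpace Filter Topology

namespace StarFunctor.Implementation

variable {𝒳 : LFCMSpace X} {𝒴 : LFCMSpace Y} {F : StarFunctor 𝒳 𝒴} (η : F.Implementation)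
variable {C D : BundledModule 𝒳} {f : X → Y}

/-- Complementary projections decrease as the entourage grows. -/
theorem norm_blockProj_near_compl_anti (M : BundledModule 𝒴) {G G' : Set (Y × Y)} (h : G ⊆ G')
    (b : Y) (x : M.H) :
    ‖M.mod.blockProj (𝒴.near G' b)ᶜ x‖ ≤ ‖M.mod.blockProj (𝒴.near G b)ᶜ x‖ :=
  M.mod.norm_blockProj_mono (Set.compl_subset_compl.2 (𝒴.near_mono h b)) x

theorem isCtrl_rankOne_vec (A : η.Anchors f D) {i : 𝒳.partition} {a : X} (hi : a ∈ (i : Set X))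
    {x : C.H} (hx : C.mod.blockProj {i} x = x) :
    IsCtrl D.mod C.mod (RelComp 𝒳.disc (RelTrans A.E)) (rankOne ℂ x (A.vec a)) := by
  refine IsCtrl.rankOne hx (A.blockProj_vec a) ?_
  rintro k rfl j hj ⟨w, z⟩ ⟨hw, hz⟩
  exact ⟨a, 𝒳.block_prod_subset_disc _ ⟨hw, hi⟩, hj ⟨hz, rfl⟩⟩

theorem exists_norm_compl_le_of_vector (A : η.Anchors f D) {i : 𝒳.partition} {a : X}
    (hi : a ∈ (i : Set X)) {x : C.H} (hx : C.mod.blockProj {i} x = x) {ε : ℝ} (hε : 0 < ε) :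
    ∃ G ∈ 𝒴.coarse.entourages,
      ‖(F.obj C).mod.blockProj (𝒴.near G (f a))ᶜ (η.op C x)‖ ≤ ε := by
  have ht := (η.isCtrl_rankOne_vec A hi hx).approximable
    (𝒳.coarse.comp_mem 𝒳.disc_mem (𝒳.coarse.transpose_mem A.E_mem))
  obtain ⟨G, hG, hGt⟩ := approximable_iff.1 (η.approximable_conj ht) (ε / 2) (by positivity)
  rw [η.conj_rankOne] at hGt
  refine ⟨_, 𝒴.coarse.comp_mem hG A.G_mem, ?_⟩
  have := hGt.norm_blockProj_compl_le (A.half_le a)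
  linarith

theorem blockProj_op_eq_zero (A : η.Anchors f D) {i : 𝒳.partition} {a : X}
    (hi : a ∈ (i : Set X)) {x : C.H} (hx : C.mod.blockProj {i} x = x) {m : 𝒴.partition}
    (hm : ∀ G ∈ 𝒴.coarse.entourages, m ∉ 𝒴.near G (f a)) :
    (F.obj C).mod.blockProj {m} (η.op C x) = 0 := by
  refine norm_le_zero_iff.1 (le_of_forall_pos_le_add fun ε hε => ?_)
  obtain ⟨G, hG, h⟩ := η.exists_norm_compl_le_of_vector A hi hx hε
  rw [zero_add]
  refine ((F.obj C).mod.norm_blockProj_mono ?_ _).trans h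
  simpa using hm G hG

/-- Vectors supported on one block are mapped uniformly close to finitely many blocks. -/
theorem exists_finite_norm_compl_le (hY : 𝒴.coarse.IsCountablyGenerated) (C : BundledModule 𝒳)
    (i : 𝒳.partition) {ε : ℝ} (hε : 0 < ε) :
    ∃ J : Set 𝒴.partition, J.Finite ∧ ∀ x, C.mod.blockProj {i} x = x →
      ‖(F.obj C).mod.blockProj Jᶜ (η.op C x)‖ ≤ ε * ‖x‖ := by
  obtain ⟨a, ha⟩ := 𝒳.block_nonempty i
  let V : Submodule ℂ C.H :=
    LinearMap.ker (ContinuousLinearMap.id ℂ C.H - C.mod.blockProj {i} : C.H →L[ℂ] C.H).toLinearMap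
  have hV : ∀ x, x ∈ V ↔ C.mod.blockProj {i} x = x := fun x => by
    simp only [V, LinearMap.mem_ker, coe_coe, sub_apply, id_apply, sub_eq_zero]
    exact eq_comm
  have : CompleteSpace V := IsClosed.completeSpace_coe
    (hs := ContinuousLinearMap.isClosed_ker (ContinuousLinearMap.id ℂ C.H - C.mod.blockProj {i}))
  let P : BundledModule 𝒳 := ⟨V, pointModule 𝒳 a V⟩
  have hι : Approximable 𝒳 P.mod.proj C.mod.proj V.subtypeL :=
    (isCtrl_pointModule (M := C.mod) ha (k := i)
      (fun x => (hV _).1 x.2)).approximable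
      (𝒳.coarse.mem_of_subset 𝒳.disc_mem (𝒳.block_prod_subset_disc i))
  obtain ⟨J, hJ, hJP⟩ := exists_finset_blockProj_eq_self hY (F.obj P).mod fun S => by
    have hS : Approximable 𝒳 P.mod.proj P.mod.proj
        (ContinuousLinearMap.adjoint (η.op P) ∘L S ∘L η.op P) :=
      (isCtrl_pointModule (M := P.mod) ha (k := i) fun x =>
        pointModule_blockProj_of_mem ha _).approximable
        (𝒳.coarse.mem_of_subset 𝒳.disc_mem (𝒳.block_prod_subset_disc i))
    have h := η.approximable_conj hS
    have hSS : η.conj (ContinuousLinearMap.adjoint (η.op P) ∘L S ∘L η.op P) = S := by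
      ext z; simp [conj_apply]
    rwa [hSS] at h
  obtain ⟨G, hG, c, hc, hcε⟩ := approximable_iff.1 (η.approximable_conj hι) ε hε
  refine ⟨⋃ j ∈ J, {m : 𝒴.partition | (m : Set Y) ×ˢ (j : Set Y) ⊆ G},
    hJ.biUnion fun j _ => LFCMSpace.finite_setOf_prod_subset hG j, fun x hx => ?_⟩
  set J' := ⋃ j ∈ J, {m : 𝒴.partition | (m : Set Y) ×ˢ (j : Set Y) ⊆ G} with hJ'
  let x' : P.H := (⟨x, (hV x).2 hx⟩ : V)
  have h1 : η.conj (C := P) V.subtypeL (η.op P x') = η.op C x := η.conj_op (C := P) _ _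
  have h2 : (F.obj C).mod.blockProj J'ᶜ (c (η.op P x')) = 0 := by
    rw [← hJP (η.op P x')]
    refine hc.blockProj_apply_eq_zero ?_ _
    intro k hk j hj hkj
    exact hk (Set.mem_biUnion hj hkj)
  have h3 : (F.obj C).mod.blockProj J'ᶜ (η.op C x) =
      (F.obj C).mod.blockProj J'ᶜ ((η.conj (C := P) V.subtypeL - c) (η.op P x')) := by
    rw [sub_apply, map_sub, h2, sub_zero, h1]
  rw [h3]
  refine ((F.obj C).mod.norm_blockProj_le _ _).trans ?_
  refine (le_of_opNorm_le _ hcε _).trans_eq ?_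
  rw [η.norm_op]
  rfl

theorem exists_norm_compl_le_of_block (hY : 𝒴.coarse.IsCountablyGenerated) (A : η.Anchors f D)
    (C : BundledModule 𝒳) {i : 𝒳.partition} {a : X} (hi : a ∈ (i : Set X)) {ε : ℝ} (hε : 0 < ε) :
    ∃ G ∈ 𝒴.coarse.entourages, ∀ x, C.mod.blockProj {i} x = x →
      ‖(F.obj C).mod.blockProj (𝒴.near G (f a))ᶜ (η.op C x)‖ ≤ ε * ‖x‖ := by
  obtain ⟨J, hJ, hJε⟩ := η.exists_finite_norm_compl_le hY C i hε
  obtain ⟨Φ, hΦmono, hΦ, hΦcof⟩ := hY.exists_cofinal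
  have hex : ∀ m : 𝒴.partition, ∃ n, (∃ n', m ∈ 𝒴.near (Φ n') (f a)) → m ∈ 𝒴.near (Φ n) (f a) := by
    intro m
    by_cases h : ∃ n', m ∈ 𝒴.near (Φ n') (f a)
    · exact ⟨h.choose, fun _ => h.choose_spec⟩
    · exact ⟨0, fun h' => absurd h' h⟩
  choose ν hν using hex
  obtain ⟨N, hN⟩ := (hJ.image ν).bddAbove
  refine ⟨Φ N, hΦ N, fun x hx => ?_⟩
  have h0 : (F.obj C).mod.blockProj ((𝒴.near (Φ N) (f a))ᶜ ∩ J) (η.op C x) = 0 := by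
    refine (F.obj C).mod.eq_zero_of_blocks fun m => ?_
    by_cases hm : m ∈ (𝒴.near (Φ N) (f a))ᶜ ∩ J
    · rw [(F.obj C).mod.blockProj_comp_of_subset (by simpa using hm)]
      refine η.blockProj_op_eq_zero A hi hx fun G hG hmG => hm.1 ?_
      obtain ⟨n, hn⟩ := hΦcof G hG
      exact 𝒴.near_mono (hΦmono (hN (Set.mem_image_of_mem ν hm.2))) _
        (hν m ⟨n, 𝒴.near_mono hn _ hmG⟩)
    · exact (F.obj C).mod.blockProj_comp_of_disjoint (by simpa using hm) _
  have hsplit : (𝒴.near (Φ N) (f a))ᶜ =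
      ((𝒴.near (Φ N) (f a))ᶜ ∩ J) ∪ ((𝒴.near (Φ N) (f a))ᶜ \ J) :=
    (Set.inter_union_sdiff _ _).symm
  rw [hsplit, (F.obj C).mod.blockProj_union
    (Set.disjoint_left.2 fun m hm hm' => hm'.2 hm.2), h0, zero_add]
  exact ((F.obj C).mod.norm_blockProj_mono (fun m hm => hm.2) _).trans (hJε x hx)

theorem norm_conj_blockProj_le (S : Set 𝒳.partition) : ‖η.conj (C.mod.blockProj S)‖ ≤ 1 := by
  refine ContinuousLinearMap.opNorm_le_bound _ zero_le_one fun w => ?_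
  rw [conj_apply, η.norm_op, one_mul]
  refine (C.mod.norm_blockProj_le _ _).trans_eq ?_
  conv_rhs => rw [← η.op_adjoint_apply w, η.norm_op]

theorem finite_setOf_not_disjoint_near (r : 𝒳.partition → X)
    (hr : ∀ i : 𝒳.partition, r i ∈ (i : Set X))
    {E : Set (X × X)} (hE : E ∈ 𝒳.coarse.entourages) (a : X) :
    {i | ¬ Disjoint (𝒳.near E a) (𝒳.near E (r i))}.Finite := by
  refine (𝒳.finite_blocks_of_isBounded (𝒳.isBounded_section
    (𝒳.coarse.comp_mem (𝒳.coarse.transpose_mem hE) hE) a)).subset fun i hi => ?_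
  obtain ⟨k, hk, hk'⟩ := Set.not_disjoint_iff.1 hi
  obtain ⟨b, hb⟩ := 𝒳.block_nonempty k
  exact ⟨r i, hr i, b, hk' ⟨hb, rfl⟩, hk ⟨hb, rfl⟩⟩

/-- The implementing unitaries displace blocks along `f`, uniformly over all blocks. -/
theorem exists_norm_compl_le (hY : 𝒴.coarse.IsCountablyGenerated) (A : η.Anchors f D)
    (C : BundledModule 𝒳) (r : 𝒳.partition → X) (hr : ∀ i : 𝒳.partition, r i ∈ (i : Set X)) {ε : ℝ}
    (hε : 0 < ε) :
    ∃ G ∈ 𝒴.coarse.entourages, ∀ (i : 𝒳.partition) (x : C.H), C.mod.blockProj {i} x = x →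
      ‖(F.obj C).mod.blockProj (𝒴.near G (f (r i)))ᶜ (η.op C x)‖ ≤ ε * ‖x‖ := by
  by_contra hcon
  push Not at hcon
  obtain ⟨Φ, hΦmono, hΦ, hΦcof⟩ := hY.exists_cofinal
  have hbad : ∀ n, ∃ i x, C.mod.blockProj {i} x = x ∧ ‖x‖ = 1 ∧
      ε < ‖(F.obj C).mod.blockProj (𝒴.near (Φ n) (f (r i)))ᶜ (η.op C x)‖ := by
    intro n
    obtain ⟨i, x, hx, h⟩ := hcon (Φ n) (hΦ n)
    have hx0 : 0 < ‖x‖ := by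
      refine norm_pos_iff.2 fun h0 => ?_
      rw [h0, _root_.map_zero, _root_.map_zero] at h
      simp at h
    refine ⟨i, (‖x‖⁻¹ : ℂ) • x, by rw [_root_.map_smul, hx], ?_, ?_⟩
    · rw [norm_smul]; simp [hx0.ne']
    · rw [_root_.map_smul, _root_.map_smul, norm_smul]
      simp only [norm_inv, Complex.norm_real, norm_norm]
      rwa [inv_mul_eq_div, lt_div_iff₀ hx0]
  have hblock : ∀ i, ∃ n, ∀ x, C.mod.blockProj {i} x = x →
      ‖(F.obj C).mod.blockProj (𝒴.near (Φ n) (f (r i)))ᶜ (η.op C x)‖ ≤ ε * ‖x‖ := by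
    intro i
    obtain ⟨G, hG, h⟩ := η.exists_norm_compl_le_of_block hY A C (hr i) hε
    obtain ⟨n, hn⟩ := hΦcof G hG
    exact ⟨n, fun x hx => (norm_blockProj_near_compl_anti _ hn _ _).trans (h x hx)⟩
  choose ν hν using hblock
  obtain ⟨g, hg, hgr⟩ := exists_seq_of_forall_finset_exists
    (fun p : ℕ × 𝒳.partition × C.H => C.mod.blockProj {p.2.1} p.2.2 = p.2.2 ∧ ‖p.2.2‖ = 1 ∧
      ε < ‖(F.obj C).mod.blockProj (𝒴.near (Φ p.1) (f (r p.2.1)))ᶜ (η.op C p.2.2)‖)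
    (fun p q => p.1 < q.1 ∧ p.2.1 ≠ q.2.1 ∧
      Disjoint (𝒳.near A.E (r p.2.1)) (𝒳.near A.E (r q.2.1))) (by
      intro s _
      have hfin : (⋃ p ∈ s, ({p.2.1} ∪
          {i | ¬ Disjoint (𝒳.near A.E (r p.2.1)) (𝒳.near A.E (r i))})).Finite :=
        s.finite_toSet.biUnion fun p _ =>
          (Set.finite_singleton _).union (finite_setOf_not_disjoint_near r hr A.E_mem _)
      obtain ⟨N₁, hN₁⟩ := (hfin.image ν).bddAbove
      obtain ⟨N₂, hN₂⟩ := (s.image Prod.fst).exists_le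
      obtain ⟨i, x, hx, hx1, hxε⟩ := hbad (max N₁ (N₂ + 1))
      have hi : i ∉ ⋃ p ∈ s, ({p.2.1} ∪
          {i | ¬ Disjoint (𝒳.near A.E (r p.2.1)) (𝒳.near A.E (r i))}) := by
        intro hi
        have h1 : ν i ≤ max N₁ (N₂ + 1) :=
          (hN₁ (Set.mem_image_of_mem ν hi)).trans (le_max_left _ _)
        have h2 := (norm_blockProj_near_compl_anti _ (hΦmono h1) _ _).trans (hν i x hx)
        rw [hx1, mul_one] at h2
        exact absurd h2 (not_le.2 hxε)
      simp only [Set.mem_iUnion, not_exists, Set.mem_union, not_or, Set.mem_singleton_iff,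
        Set.mem_ofPred_eq, not_not] at hi
      refine ⟨(max N₁ (N₂ + 1), i, x), ⟨hx, hx1, hxε⟩, fun p hp => ⟨?_, ?_, ?_⟩⟩
      · exact lt_of_lt_of_le (Nat.lt_succ_of_le (hN₂ _ (Finset.mem_image_of_mem _ hp)))
          (le_max_right _ _)
      · exact fun h => (hi p hp).1 h.symm
      · exact (hi p hp).2)
  have hgn : ∀ n, n ≤ (g n).1 := fun n => (strictMono_nat_of_lt_succ (f := fun n => (g n).1)
    fun n => (hgr n (n + 1) (Nat.lt_succ_self n)).1).le_apply
  have hdis : ∀ m n, m ≠ n →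
      Disjoint (𝒳.near A.E (r (g m).2.1)) (𝒳.near A.E (r (g n).2.1)) := by
    intro m n hmn
    rcases lt_or_gt_of_ne hmn with h | h
    · exact (hgr m n h).2.2
    · exact (hgr n m h).2.2.symm
  have hx : Orthonormal ℂ fun n => (g n).2.2 :=
    orthonormal_of_blocks (M := C.mod) (fun n => (hg n).2.1) (fun n => (hg n).1) fun m n hmn => by
      simpa using (hgr m n hmn).2.1
  have hy : Orthonormal ℂ fun n => A.vec (r (g n).2.1) :=
    orthonormal_of_blocks (M := D.mod) (fun n => A.norm_vec _) (fun n => A.blockProj_vec _)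
      fun m n hmn => hdis m n hmn.ne
  obtain ⟨t, ht⟩ := exists_hasSum_rankOne hy hx
  have htc : IsCtrl D.mod C.mod (RelComp 𝒳.disc (RelTrans A.E)) t :=
    HasSum.isCtrl ht fun n => η.isCtrl_rankOne_vec A (hr _) (hg n).1
  obtain ⟨G₁, hG₁, c, hc, hcε⟩ := approximable_iff.1 (η.approximable_conj (htc.approximable
    (𝒳.coarse.comp_mem 𝒳.disc_mem (𝒳.coarse.transpose_mem A.E_mem)))) (ε / 4) (by positivity)
  obtain ⟨G₂, hG₂, hU⟩ := η.exists_uniform_conj_blockProj hY D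
    (ε := (ε / 4) / (‖c‖ + 1)) (by positivity)
  have htm : ∀ m, t ∘L D.mod.blockProj (𝒳.near A.E (r (g m).2.1)) =
      rankOne ℂ (g m).2.2 (A.vec (r (g m).2.1)) := by
    intro m
    ext z
    refine (ht (D.mod.blockProj (𝒳.near A.E (r (g m).2.1)) z)).unique ?_
    convert hasSum_single m ?_ using 1
    · rw [rankOne_apply, rankOne_apply, ← D.mod.inner_blockProj_left, A.blockProj_vec]
    · intro n hn
      rw [rankOne_apply, ← D.mod.inner_blockProj_left, ← A.blockProj_vec (r (g n).2.1),
        D.mod.blockProj_comp_of_disjoint (hdis m n hn.symm), inner_zero_left, zero_smul]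
  have hrank : ∀ m, ApproxWithin (F.obj D).mod (F.obj C).mod (RelComp G₁ G₂) (ε / 2)
      (rankOne ℂ (η.op C (g m).2.2) (η.op D (A.vec (r (g m).2.1)))) := by
    intro m
    obtain ⟨d, hd, hdε⟩ := hU (𝒳.near A.E (r (g m).2.1))
    refine ⟨c ∘L d, hc.comp hd, ?_⟩
    set Q := η.conj (D.mod.blockProj (𝒳.near A.E (r (g m).2.1))) with hQ
    have h1 : rankOne ℂ (η.op C (g m).2.2) (η.op D (A.vec (r (g m).2.1))) - c ∘L d =
        (η.conj t - c) ∘L Q + c ∘L (Q - d) := by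
      rw [← η.conj_rankOne, ← htm]
      ext z
      simp [conj_apply, hQ]
    rw [h1]
    have h2 : ‖(η.conj t - c) ∘L Q‖ ≤ ε / 4 * 1 :=
      (opNorm_comp_le _ _).trans (mul_le_mul hcε (η.norm_conj_blockProj_le _) (norm_nonneg _)
        (by positivity))
    have h3 : ‖c ∘L (Q - d)‖ ≤ ‖c‖ * ((ε / 4) / (‖c‖ + 1)) :=
      (opNorm_comp_le _ _).trans (mul_le_mul_of_nonneg_left hdε (norm_nonneg _))
    have h4 : ‖c‖ * ((ε / 4) / (‖c‖ + 1)) ≤ ε / 4 := by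
      rw [mul_div_assoc', div_le_iff₀ (by positivity)]
      nlinarith [norm_nonneg c]
    refine (norm_add_le _ _).trans ?_
    linarith
  obtain ⟨N, hN⟩ := hΦcof _ (𝒴.coarse.comp_mem (𝒴.coarse.comp_mem hG₁ hG₂) A.G_mem)
  have h1 := (hrank N).norm_blockProj_compl_le (A.half_le _)
  have h2 := norm_blockProj_near_compl_anti (F.obj C) (hN.trans (hΦmono (hgn N)))
    (f (r (g N).2.1)) (η.op C (g N).2.2)
  have h3 := (hg N).2.2
  linarith

end StarFunctor.Implementation

end Displacement

section Pushforward

open ContinuousLinearMap InnerProductSpace Filter Topology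

section SignedSums

variable [NormedAddCommGroup H₁] [InnerProductSpace ℂ H₁]

/-- The averaged square norm of all signed sums of finitely many vectors. -/
theorem sum_powerset_norm_signed_sum_sq {ι : Type*} [DecidableEq ι] (J : Finset ι) (b : ι → H₁) :
    ∑ S ∈ J.powerset, ‖∑ i ∈ S, b i - ∑ i ∈ J \ S, b i‖ ^ 2 =
      2 ^ J.card * ∑ i ∈ J, ‖b i‖ ^ 2 := by
  induction J using Finset.induction_on with
  | empty => simp
  | insert j J hj ih =>
    rw [Finset.sum_powerset_insert hj, ← Finset.sum_add_distrib, Finset.sum_insert hj,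
      Finset.card_insert_of_notMem hj, mul_add, pow_succ, mul_right_comm _ _ (∑ i ∈ J, _), ← ih,
      Finset.sum_mul]
    have hterm : ∀ S ∈ J.powerset,
        ‖∑ i ∈ S, b i - ∑ i ∈ insert j J \ S, b i‖ ^ 2 +
          ‖∑ i ∈ insert j S, b i - ∑ i ∈ insert j J \ insert j S, b i‖ ^ 2 =
        2 * ‖b j‖ ^ 2 + ‖∑ i ∈ S, b i - ∑ i ∈ J \ S, b i‖ ^ 2 * 2 := by
      intro S hS
      have hjS : j ∉ S := fun h => hj (Finset.mem_powerset.1 hS h)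
      have hjJ : j ∉ J \ S := fun h => hj (Finset.mem_sdiff.1 h).1
      have h1 : insert j J \ insert j S = J \ S := by
        ext i
        simp only [Finset.mem_sdiff, Finset.mem_insert, not_or]
        constructor
        · rintro ⟨h | h, h', h''⟩
          · exact absurd h h'
          · exact ⟨h, h''⟩
        · rintro ⟨h, h'⟩
          exact ⟨Or.inr h, fun h'' => hj (h'' ▸ h), h'⟩
      rw [h1, Finset.insert_sdiff_of_notMem _ hjS, Finset.sum_insert hjJ, Finset.sum_insert hjS]
      have := parallelogram_law_with_norm ℂ (∑ i ∈ S, b i - ∑ i ∈ J \ S, b i) (b j)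
      have e1 : ∑ i ∈ S, b i - (b j + ∑ i ∈ J \ S, b i) =
          (∑ i ∈ S, b i - ∑ i ∈ J \ S, b i) - b j := by abel
      have e2 : b j + ∑ i ∈ S, b i - ∑ i ∈ J \ S, b i =
          (∑ i ∈ S, b i - ∑ i ∈ J \ S, b i) + b j := by abel
      rw [e1, e2]
      linarith
    rw [Finset.sum_congr rfl hterm, Finset.sum_add_distrib, Finset.sum_const, Finset.card_powerset]
    simp only [nsmul_eq_mul, Nat.cast_pow, Nat.cast_ofNat]
    ring

theorem sum_powerset_norm_signed_sum_le {ι : Type*} [DecidableEq ι] (J : Finset ι) (b : ι → H₁)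
    {R : ℝ} (hR : 0 ≤ R) (hb : ∑ i ∈ J, ‖b i‖ ^ 2 ≤ R ^ 2) :
    ∑ S ∈ J.powerset, ‖∑ i ∈ S, b i - ∑ i ∈ J \ S, b i‖ ≤ 2 ^ J.card * R := by
  refine abs_le_of_sq_le_sq' ?_ (by positivity) |>.2
  refine sq_sum_le_card_mul_sum_sq.trans ?_
  rw [sum_powerset_norm_signed_sum_sq, Finset.card_powerset, mul_pow]
  push_cast
  rw [← mul_assoc, ← sq]
  exact mul_le_mul_of_nonneg_left hb (by positivity)

end SignedSums

theorem CoarseModule.sum_norm_blockProj_sq_le [NormedAddCommGroup H₁] [InnerProductSpace ℂ H₁]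
    [CompleteSpace H₁] {𝒳 : LFCMSpace X} (M : CoarseModule 𝒳 H₁) (J : Finset 𝒳.partition)
    (x : H₁) : ∑ i ∈ J, ‖M.blockProj {i} x‖ ^ 2 ≤ ‖x‖ ^ 2 := by
  have h : ∀ i, ‖M.blockProj {i} x‖ ^ 2 = RCLike.re (inner ℂ (M.blockProj {i} x) x) := by
    intro i
    rw [← inner_self_eq_norm_sq (𝕜 := ℂ), ← M.inner_blockProj_left, M.blockProj_idem]
  simp only [h]
  rw [← map_sum, ← sum_inner, ← M.blockProj_coe_finset]
  refine (RCLike.re_le_norm _).trans ((norm_inner_le_norm _ _).trans ?_)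
  rw [sq]
  exact mul_le_mul_of_nonneg_right (M.norm_blockProj_le _ _) (norm_nonneg _)

variable [NormedAddCommGroup H₁] [InnerProductSpace ℂ H₁] [CompleteSpace H₁]
variable {𝒳 : LFCMSpace X} {𝒴 : LFCMSpace Y} {f : X → Y}

/-- The pushforward of a coarse module along a coarse measurable map. -/
def CoarseModule.pushforward (M : CoarseModule 𝒳 H₁) (hf : IsCoarseMeasurableMap 𝒳 𝒴 f) :
    CoarseModule 𝒴 H₁ where
  proj B := M.proj (f ⁻¹' B)
  proj_empty := M.proj_empty
  proj_selfAdjoint B hB := M.proj_selfAdjoint _ (hf.2 B hB)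
  proj_inter hA hB := M.proj_inter (hf.2 _ hA) (hf.2 _ hB)
  proj_union hA hB h := M.proj_union (hf.2 _ hA) (hf.2 _ hB) (h.preimage f)
  nondeg := by
    refine M.nondeg.mono ?_
    rw [SetLike.coe_subset_coe]
    refine Submodule.span_le.2 (Set.iUnion₂_subset ?_)
    rintro A ⟨hA, E, hE, hAE⟩ _ ⟨x, rfl⟩
    let S : Set 𝒴.partition := {i | ((i : Set Y) ∩ f '' A).Nonempty}
    have hS : A ⊆ f ⁻¹' 𝒴.blockUnion S := by
      intro a ha
      obtain ⟨i, hi⟩ := 𝒴.exists_block (f a)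
      exact 𝒴.mem_blockUnion.2 ⟨i, ⟨f a, hi, a, ha, rfl⟩, hi⟩
    rw [SetLike.mem_coe, ← M.proj_of_subset hA (hf.2 _ (𝒴.blockUnion_meas S)) hS]
    refine Submodule.subset_span (Set.mem_biUnion (x := 𝒴.blockUnion S) ⟨𝒴.blockUnion_meas S,
      RelComp 𝒴.disc (RelComp ((fun p : X × X => (f p.1, f p.2)) '' E) 𝒴.disc),
      𝒴.coarse.comp_mem 𝒴.disc_mem (𝒴.coarse.comp_mem (hf.1 E hE) 𝒴.disc_mem), ?_⟩ ⟨_, rfl⟩)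
    rintro ⟨y, z⟩ ⟨hy, hz⟩
    obtain ⟨i, ⟨_, hi, a, ha, rfl⟩, hyi⟩ := 𝒴.mem_blockUnion.1 hy
    obtain ⟨j, ⟨_, hj, b, hb, rfl⟩, hzj⟩ := 𝒴.mem_blockUnion.1 hz
    exact ⟨f a, 𝒴.block_prod_subset_disc i ⟨hyi, hi⟩, f b, ⟨(a, b), hAE ⟨ha, hb⟩, rfl⟩,
      𝒴.block_prod_subset_disc j ⟨hj, hzj⟩⟩

theorem isCtrl_pushforward_comp_blockProj [NormedAddCommGroup H₂] [InnerProductSpace ℂ H₂]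
    [CompleteSpace H₂] (M : CoarseModule 𝒳 H₁) (N : CoarseModule 𝒴 H₂)
    (hf : IsCoarseMeasurableMap 𝒳 𝒴 f) (G : Set (Y × Y)) {i : 𝒳.partition} {a : X}
    (ha : a ∈ (i : Set X)) (T : H₁ →L[ℂ] H₂) :
    IsCtrl (M.pushforward hf) N
      (RelComp G (RelComp ((fun p : X × X => (f p.1, f p.2)) '' 𝒳.disc) 𝒴.disc))
      (N.blockProj (𝒴.near G (f a)) ∘L T ∘L M.blockProj {i}) := by
  intro k l x hx
  have hk : k ∈ 𝒴.near G (f a) := by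
    by_contra hk
    exact hx (N.blockProj_comp_of_disjoint (by simpa using hk) _)
  have hl : ((i : Set X) ∩ f ⁻¹' (l : Set Y)).Nonempty := by
    by_contra hl
    rw [Set.not_nonempty_iff_eq_empty] at hl
    apply hx
    have h0 : M.blockProj {i} ((M.pushforward hf).blockProj {l} x) = 0 := by
      rw [M.blockProj_singleton, (M.pushforward hf).blockProj_singleton]
      change (M.proj i ∘L M.proj (f ⁻¹' l)) x = 0
      rw [← M.proj_inter (𝒳.block_meas i) (hf.2 _ (𝒴.block_meas l)), hl, M.proj_empty]
      rfl
    rw [coe_comp, Function.comp_apply, coe_comp, Function.comp_apply, h0]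
    simp
  obtain ⟨b, hb, hbl⟩ := hl
  rintro ⟨w, z⟩ ⟨hw, hz⟩
  exact ⟨f a, hk ⟨hw, rfl⟩, f b, ⟨(a, b), 𝒳.block_prod_subset_disc i ⟨ha, hb⟩, rfl⟩,
    𝒴.block_prod_subset_disc l ⟨hbl, hz⟩⟩

namespace StarFunctor.Implementation

variable {F : StarFunctor 𝒳 𝒴} (η : F.Implementation) {C D : BundledModule 𝒳}

theorem adjoint_conj_blockProj (S : Set 𝒳.partition) :
    ContinuousLinearMap.adjoint (η.conj (C.mod.blockProj S)) = η.conj (C.mod.blockProj S) := by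
  have h : ContinuousLinearMap.adjoint (C.mod.blockProj S) = C.mod.blockProj S :=
    C.mod.adjoint_proj (𝒳.blockUnion_meas S)
  simp only [conj, adjoint_comp, adjoint_adjoint, h]
  rfl

/-- Averaging over signs turns uniform control of the conjugated projections and of the
displacement of blocks into control of the unitary itself on finitely many blocks. -/
theorem approxWithin_comp_blockProj_finset (hf : IsCoarseMeasurableMap 𝒳 𝒴 f)
    {r : 𝒳.partition → X} (hr : ∀ i : 𝒳.partition, r i ∈ (i : Set X)) {ε : ℝ} (hε : 0 ≤ ε)
    {G G' : Set (Y × Y)}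
    (hG : ∀ S, ApproxWithin (F.obj C).mod (F.obj C).mod G ε (η.conj (C.mod.blockProj S)))
    (hG' : ∀ (i : 𝒳.partition) (x : C.H), C.mod.blockProj {i} x = x →
      ‖(F.obj C).mod.blockProj (𝒴.near G' (f (r i)))ᶜ (η.op C x)‖ ≤ ε * ‖x‖)
    (J : Finset 𝒳.partition) :
    ApproxWithin (C.mod.pushforward hf) (F.obj C).mod
      (RelComp (RelTrans G)
        (RelComp G' (RelComp ((fun p : X × X => (f p.1, f p.2)) '' 𝒳.disc) 𝒴.disc)))
      (4 * ε) (η.op C ∘L C.mod.blockProj (J : Set 𝒳.partition)) := by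
  classical
  choose c hc hcε using hG
  let K : 𝒳.partition → C.H →L[ℂ] (F.obj C).H := fun i =>
    (F.obj C).mod.blockProj (𝒴.near G' (f (r i))) ∘L η.op C ∘L C.mod.blockProj {i}
  let m : Finset 𝒳.partition → C.H →L[ℂ] (F.obj C).H := fun S => ∑ i ∈ S, K i - ∑ i ∈ J \ S, K i
  let d : Finset 𝒳.partition → (F.obj C).H →L[ℂ] (F.obj C).H := fun S =>
    ContinuousLinearMap.adjoint (c S - c ↑(J \ S))
  let U : Finset 𝒳.partition → (F.obj C).H →L[ℂ] (F.obj C).H := fun S =>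
    η.conj (C.mod.blockProj S) - η.conj (C.mod.blockProj ↑(J \ S))
  have hK : ∀ i, IsCtrl (C.mod.pushforward hf) (F.obj C).mod
      (RelComp G' (RelComp ((fun p : X × X => (f p.1, f p.2)) '' 𝒳.disc) 𝒴.disc)) (K i) :=
    fun i => isCtrl_pushforward_comp_blockProj C.mod (F.obj C).mod hf G' (hr i) (η.op C)
  have hdU : ∀ S, ‖d S - U S‖ ≤ 2 * ε := by
    intro S
    have hU : U S = ContinuousLinearMap.adjoint (U S) := by
      simp only [U, map_sub, adjoint_conj_blockProj]
    rw [hU]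
    simp only [d]
    rw [← map_sub, LinearIsometryEquiv.norm_map]
    have h1 : c S - c ↑(J \ S) - U S =
        (η.conj (C.mod.blockProj ↑(J \ S)) - c ↑(J \ S)) - (η.conj (C.mod.blockProj S) - c S) := by
      simp only [U]; abel
    rw [h1]
    refine (norm_sub_le _ _).trans ?_
    linarith [hcε S, hcε ↑(J \ S)]
  have hU2 : ∀ S, ‖U S‖ ≤ 2 := fun S => (norm_sub_le _ _).trans (by
    linarith [η.norm_conj_blockProj_le (C := C) (S : Set 𝒳.partition),
      η.norm_conj_blockProj_le (C := C) ((J \ S : Finset 𝒳.partition) : Set 𝒳.partition)])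
  have hUsq : ∀ S ∈ J.powerset, ∀ x,
      U S (∑ i ∈ S, η.op C (C.mod.blockProj {i} x) - ∑ i ∈ J \ S, η.op C (C.mod.blockProj {i} x)) =
        η.op C (C.mod.blockProj (J : Set 𝒳.partition) x) := by
    intro S hS x
    have hdis : Disjoint (S : Set 𝒳.partition) (↑(J \ S) : Set 𝒳.partition) := by
      rw [Finset.disjoint_coe]; exact Finset.disjoint_sdiff
    rw [← map_sum, ← map_sum, ← C.mod.blockProj_coe_finset, ← C.mod.blockProj_coe_finset]
    have hJ : (J : Set 𝒳.partition) = (S : Set 𝒳.partition) ∪ (↑(J \ S) : Set 𝒳.partition) := by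
      rw [← Finset.coe_union, Finset.union_sdiff_of_subset (Finset.mem_powerset.1 hS)]
    conv_rhs => rw [hJ, C.mod.blockProj_union hdis]
    simp only [U, sub_apply, map_sub, _root_.map_add, conj_op, C.mod.blockProj_idem,
      C.mod.blockProj_comp_of_disjoint hdis, C.mod.blockProj_comp_of_disjoint hdis.symm,
      _root_.map_zero]
    abel
  refine ⟨((2 : ℂ) ^ J.card)⁻¹ • ∑ S ∈ J.powerset, d S ∘L m S, ?_, ?_⟩
  · exact (IsCtrl.sum _ fun S _ => ((hc _).sub (hc _)).adjoint.comp
      ((IsCtrl.sum _ fun i _ => hK i).sub (IsCtrl.sum _ fun i _ => hK i))).smul _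
  refine ContinuousLinearMap.opNorm_le_bound _ (by positivity) fun x => ?_
  have hm : ∑ S ∈ J.powerset, ‖m S x‖ ≤ 2 ^ J.card * ‖x‖ := by
    have := sum_powerset_norm_signed_sum_le J (fun i => K i x) (norm_nonneg x) (by
      refine le_trans (Finset.sum_le_sum fun i _ => ?_) (C.mod.sum_norm_blockProj_sq_le J x)
      refine pow_le_pow_left₀ (norm_nonneg _) (((F.obj C).mod.norm_blockProj_le _ _).trans ?_) 2
      simp)
    simpa [m, sub_apply, sum_apply] using this
  let b : 𝒳.partition → (F.obj C).H := fun i => K i x - η.op C (C.mod.blockProj {i} x)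
  have hb : ∑ S ∈ J.powerset, ‖∑ i ∈ S, b i - ∑ i ∈ J \ S, b i‖ ≤ 2 ^ J.card * (ε * ‖x‖) := by
    refine sum_powerset_norm_signed_sum_le J b (by positivity) ?_
    calc ∑ i ∈ J, ‖b i‖ ^ 2 ≤ ∑ i ∈ J, ε ^ 2 * ‖C.mod.blockProj {i} x‖ ^ 2 := by
          refine Finset.sum_le_sum fun i _ => ?_
          rw [← mul_pow]
          refine pow_le_pow_left₀ (norm_nonneg _) ?_ 2
          have h1 := hG' i (C.mod.blockProj {i} x) (C.mod.blockProj_idem _ _)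
          rw [(F.obj C).mod.blockProj_compl, norm_sub_rev] at h1
          exact h1
      _ = ε ^ 2 * ∑ i ∈ J, ‖C.mod.blockProj {i} x‖ ^ 2 := by rw [Finset.mul_sum]
      _ ≤ (ε * ‖x‖) ^ 2 := by
          rw [mul_pow]
          exact mul_le_mul_of_nonneg_left (C.mod.sum_norm_blockProj_sq_le J x) (by positivity)
  have hterm : ∀ S ∈ J.powerset, ‖η.op C (C.mod.blockProj (J : Set 𝒳.partition) x) - d S (m S x)‖ ≤
      2 * ε * ‖m S x‖ + 2 * ‖∑ i ∈ S, b i - ∑ i ∈ J \ S, b i‖ := by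
    intro S hS
    have h1 : η.op C (C.mod.blockProj (J : Set 𝒳.partition) x) - d S (m S x) =
        -((d S - U S) (m S x) + U S (∑ i ∈ S, b i - ∑ i ∈ J \ S, b i)) := by
      have h2 : ∑ i ∈ S, b i - ∑ i ∈ J \ S, b i = m S x -
          (∑ i ∈ S, η.op C (C.mod.blockProj {i} x) -
            ∑ i ∈ J \ S, η.op C (C.mod.blockProj {i} x)) := by
        simp only [b, m, Finset.sum_sub_distrib, sub_apply, sum_apply]
        abel
      rw [h2, map_sub, hUsq S hS, sub_apply (d S) (U S)]
      abel
    rw [h1, norm_neg]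
    exact (norm_add_le _ _).trans (add_le_add (le_of_opNorm_le _ (hdU S) _)
      (le_of_opNorm_le _ (hU2 S) _))
  set y := η.op C (C.mod.blockProj (J : Set 𝒳.partition) x) with hy
  have hpow : ((2 : ℂ) ^ J.card) ≠ 0 := pow_ne_zero _ two_ne_zero
  have hsum : (η.op C ∘L C.mod.blockProj (J : Set 𝒳.partition) -
      ((2 : ℂ) ^ J.card)⁻¹ • ∑ S ∈ J.powerset, d S ∘L m S) x =
      ((2 : ℂ) ^ J.card)⁻¹ • ∑ S ∈ J.powerset, (y - d S (m S x)) := by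
    rw [Finset.sum_sub_distrib, Finset.sum_const, Finset.card_powerset, smul_sub,
      ← Nat.cast_smul_eq_nsmul ℂ, Nat.cast_pow, Nat.cast_ofNat, inv_smul_smul₀ hpow]
    simp [sub_apply, sum_apply, hy]
  rw [hsum, norm_smul, norm_inv, norm_pow, Complex.norm_two, inv_mul_le_iff₀ (by positivity)]
  calc ‖∑ S ∈ J.powerset, (y - d S (m S x))‖
      ≤ ∑ S ∈ J.powerset, (2 * ε * ‖m S x‖ + 2 * ‖∑ i ∈ S, b i - ∑ i ∈ J \ S, b i‖) :=
        norm_sum_le_of_le _ hterm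
    _ = 2 * ε * ∑ S ∈ J.powerset, ‖m S x‖ +
        2 * ∑ S ∈ J.powerset, ‖∑ i ∈ S, b i - ∑ i ∈ J \ S, b i‖ := by
        rw [Finset.sum_add_distrib, Finset.mul_sum, Finset.mul_sum]
    _ ≤ 2 * ε * (2 ^ J.card * ‖x‖) + 2 * (2 ^ J.card * (ε * ‖x‖)) := by gcongr
    _ = 2 ^ J.card * (4 * ε * ‖x‖) := by ring

/-- The implementing unitaries are approximable over the target. -/
theorem approximable_pushforward (hY : 𝒴.coarse.IsCountablyGenerated)
    (hf : IsCoarseMeasurableMap 𝒳 𝒴 f) (A : η.Anchors f D) (C : BundledModule 𝒳) :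
    Approximable 𝒴 (C.mod.pushforward hf).proj (F.obj C).mod.proj (η.op C) := by
  rw [approximable_iff]
  intro ε hε
  choose r hr using 𝒳.block_nonempty
  obtain ⟨G, hG, hGε⟩ := η.exists_uniform_conj_blockProj hY C (ε := ε / 4) (by positivity)
  obtain ⟨G', hG', hGε'⟩ := η.exists_norm_compl_le hY A C r hr (ε := ε / 4) (by positivity)
  refine ⟨_, 𝒴.coarse.comp_mem (𝒴.coarse.transpose_mem hG) (𝒴.coarse.comp_mem hG'
    (𝒴.coarse.comp_mem (hf.1 _ 𝒳.disc_mem) 𝒴.disc_mem)), ?_⟩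
  classical
  refine ApproxWithin.of_weak_limit (u := Ultrafilter.of (atTop : Filter (Finset 𝒳.partition)))
    (T := fun J => η.op C ∘L C.mod.blockProj (J : Set 𝒳.partition)) (R := 1) ?_ ?_ ?_
  · intro x y
    have h1 : Tendsto (fun J : Finset 𝒳.partition => C.mod.blockProj (J : Set 𝒳.partition) x)
        atTop (𝓝 x) := by
      rw [Metric.tendsto_nhds]
      intro δ hδ
      obtain ⟨J₀, hJ₀⟩ := C.mod.exists_finset_approx x (half_pos hδ)
      filter_upwards [eventually_ge_atTop J₀] with J hJ
      rw [dist_eq_norm, norm_sub_rev]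
      exact (hJ₀ J (Finset.coe_subset.2 hJ)).trans_lt (half_lt_self hδ)
    have h2 : Continuous fun z : C.H => inner ℂ (η.op C z) y := by fun_prop
    exact ((h2.tendsto x).comp h1).mono_left (Ultrafilter.of_le _)
  · refine Eventually.of_forall fun J =>
      ContinuousLinearMap.opNorm_le_bound _ zero_le_one fun x => ?_
    rw [coe_comp, Function.comp_apply, η.norm_op, one_mul]
    exact C.mod.norm_blockProj_le _ _
  · refine Eventually.of_forall fun J => ?_
    exact (η.approxWithin_comp_blockProj_finset hf hr (by positivity) hGε hGε' J).mono subset_rfl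
      (by linarith)

end StarFunctor.Implementation

theorem isCentralUnitary_id (M : CoarseModule 𝒳 H₁) :
    IsCentralUnitary 𝒳 M (ContinuousLinearMap.id ℂ H₁) := by
  have h : ContinuousLinearMap.adjoint (ContinuousLinearMap.id ℂ H₁) =
      ContinuousLinearMap.id ℂ H₁ := by
    rw [eq_comm, eq_adjoint_iff]
    simp
  exact ⟨approximable_id, ⟨by rw [h, comp_id], by rw [h, comp_id]⟩,
    fun t _ => by rw [id_comp, comp_id]⟩

end Pushforward

/-- A full and faithful *-functor is naturally isomorphic, modulo central
unitaries, to the pushforward functor along a coarse measurable map representing the induced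
coarse embedding. -/
theorem starFunctor_iso_pushforward_mod_central {X Y : Type}
    (𝒳 : LFCMSpace X) (𝒴 : LFCMSpace Y)
    (hX : 𝒳.coarse.IsCountablyGenerated) (hY : 𝒴.coarse.IsCountablyGenerated)
    (F : StarFunctor 𝒳 𝒴) (hfull : F.Full) (hfaithful : F.Faithful)
    (hfX : ∃ C : BundledModule 𝒳, IsFaithfulMod 𝒳 C.mod)
    (f : X → Y) (hf : IsCoarseMeasurableMap 𝒳 𝒴 f)
    (hemb : CoarseSpace.IsCoarseEmbedding 𝒳.coarse 𝒴.coarse f)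
    (hrep : RepresentsInducedEmbedding F f) :
    ∃ η : ∀ C : BundledModule 𝒳, C.H →L[ℂ] (F.obj C).H,
      (∀ C : BundledModule 𝒳, IsUnitaryOp (η C) ∧
        Approximable 𝒴 (fun B : Set Y => C.mod.proj (f ⁻¹' B)) (F.obj C).mod.proj (η C)) ∧
      ∀ (C D : BundledModule 𝒳) (t : C.H →L[ℂ] D.H)
        (ht : Approximable 𝒳 C.mod.proj D.mod.proj t),
        ∃ (u : C.H →L[ℂ] C.H) (v : D.H →L[ℂ] D.H),
          IsCentralUnitary 𝒳 C.mod u ∧ IsCentralUnitary 𝒳 D.mod v ∧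
          ∃ h' : Approximable 𝒳 C.mod.proj D.mod.proj (v ∘L t ∘L u),
            F.map (v ∘L t ∘L u) h' ∘L η C = η D ∘L t := by
  obtain ⟨η, hη, hnat⟩ := StarFunctor.exists_natural_unitary hfull hfaithful
  let Η : F.Implementation := ⟨η, hη, hnat⟩
  obtain ⟨D, hD⟩ := hfX
  obtain ⟨A⟩ := Η.exists_anchors hrep hD
  refine ⟨η, fun C => ⟨hη C, Η.approximable_pushforward hY hf A C⟩, fun C D t _ =>
    ⟨.id ℂ C.H, .id ℂ D.H, isCentralUnitary_id C.mod, isCentralUnitary_id D.mod,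
      by rwa [ContinuousLinearMap.comp_id, ContinuousLinearMap.id_comp], ?_⟩⟩
  rw [hnat]
  simp
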